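/- arXiv:1912.04866 — 4 statements merged into one kernel-verified Lean document; each statement's English description precedes it below -/
import Mathlib

section
/- Let K be a field of characteristic zero, R = K[x,y,z], and let a, b, c, α, β, γ be integers with 1 ≤ α ≤ a−1, 1 ≤ β ≤ b−1, 1 ≤ γ ≤ c−1 and α + γ = b. Let I = (x^a, y^b − x^α z^γ, z^c, x^{a−α} y^{b−β}, y^{b−β} z^{c−γ}) ⊆ R. If at least one of the integers a, b, c is less than or equal to 3, then the graded Artinian algebra R/I has the weak Lefschetz property. -/
open MvPolynomial

/-- The degree-`i` graded component of `R/I`, i.e. the image in `R/I` of the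
space of homogeneous polynomials of degree `i`. -/
noncomputable def grComponent (K : Type*) [Field K]
    (I : Ideal (MvPolynomial (Fin 3) K)) (i : ℕ) :
    Submodule K (MvPolynomial (Fin 3) K ⧸ I) :=
  (MvPolynomial.homogeneousSubmodule (Fin 3) K i).map
    (Ideal.Quotient.mkₐ K I).toLinearMap

/-- The Hilbert function of `R/I`. -/
noncomputable def hilb (K : Type*) [Field K]
    (I : Ideal (MvPolynomial (Fin 3) K)) (i : ℕ) : ℕ :=
  Module.finrank K (grComponent K I i)

/-- `R/I` has the weak Lefschetz property: there is a linear form `L` such that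
for every `i`, multiplication by `L` from `[R/I]_i` to `[R/I]_{i+1}` is
injective or surjective. -/
def hasWLP (K : Type*) [Field K] (I : Ideal (MvPolynomial (Fin 3) K)) : Prop :=
  ∃ L : MvPolynomial (Fin 3) K, L.IsHomogeneous 1 ∧
    ∀ i : ℕ,
      (∀ u ∈ grComponent K I i, ∀ v ∈ grComponent K I i,
          Ideal.Quotient.mk I L * u = Ideal.Quotient.mk I L * v → u = v) ∨
      (∀ w ∈ grComponent K I (i + 1), ∃ u ∈ grComponent K I i,
          Ideal.Quotient.mk I L * u = w)

/-- The relations defining `R/I`, for three elements of a commutative ring. -/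
structure WLPRelations {S : Type*} [CommRing S] (a b c α β γ : ℕ) (x y z : S) : Prop where
  hx : x ^ a = 0
  hy : y ^ b = x ^ α * z ^ γ
  hz : z ^ c = 0
  hxy : x ^ (a - α) * y ^ (b - β) = 0
  hyz : y ^ (b - β) * z ^ (c - γ) = 0

/-- Some linear form `L` makes `R/(I, L)` vanish in degree `d`, phrased through the
`K`-algebras over `R/(I, L)`. -/
def VanishesModLinear.{u} (K : Type u) [Field K] (a b c α β γ d : ℕ) : Prop :=
  ∃ p q r : K, ∀ (S : Type u) [CommRing S] [Algebra K S] (x y z : S),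
    WLPRelations a b c α β γ x y z → p • x + q • y + r • z = 0 →
    ∀ i j k : ℕ, i + j + k = d → x ^ i * y ^ j * z ^ k = 0

section Vanishing

variable {S : Type*} [CommRing S]

theorem eq_zero_of_natCast_mul_eq_zero (K : Type*) [Field K] [CharZero K] [Algebra K S]
    {n : ℕ} (hn : n ≠ 0) {s : S} (h : (n : S) * s = 0) : s = 0 := by
  have h1 : (n : K) • s = 0 := by
    rw [Algebra.smul_def, map_natCast, h]
  exact (smul_eq_zero_iff_right (Nat.cast_ne_zero.mpr hn)).mp h1

theorem pow_mul_pow_eq_zero_of_le {u v : S} {m n m' n' : ℕ} (h : u ^ m * v ^ n = 0)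
    (hm : m ≤ m') (hn : n ≤ n') : u ^ m' * v ^ n' = 0 := by
  obtain ⟨s, rfl⟩ := Nat.exists_eq_add_of_le hm
  obtain ⟨t, rfl⟩ := Nat.exists_eq_add_of_le hn
  linear_combination u ^ s * v ^ t * h

theorem two_mul_add_pow_of_cube_eq_zero {x : S} (hx : x ^ 3 = 0) (y : S) (n : ℕ) :
    2 * (x + y) ^ (n + 2) =
      2 * y ^ (n + 2) + 2 * (n + 2) * (x * y ^ (n + 1)) + (n + 2) * (n + 1) * (x ^ 2 * y ^ n) := by
  induction n with
  | zero => push_cast; ring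
  | succ n ih =>
    push_cast
    linear_combination (x + y) * ih + (n + 2) * (n + 1) * y ^ n * hx

theorem mul_add_pow_of_cube_eq_zero {x : S} (hx : x ^ 3 = 0) (y : S) (n : ℕ) :
    x * (x + y) ^ (n + 1) = x * y ^ (n + 1) + (n + 1) * (x ^ 2 * y ^ n) := by
  induction n with
  | zero => push_cast; ring
  | succ n ih =>
    push_cast
    linear_combination (x + y) * ih + (n + 1) * y ^ n * hx

theorem pow_mul_add_pow_of_sq_mul_pow_eq_zero {x y : S} {m : ℕ} (h : x ^ 2 * y ^ m = 0) (k : ℕ) :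
    y ^ m * (x + y) ^ (k + 1) = y ^ (m + k + 1) + (k + 1) * (x * y ^ (m + k)) := by
  induction k with
  | zero => push_cast; ring
  | succ k ih =>
    push_cast
    linear_combination (x + y) * ih + (k + 1) * y ^ k * h

theorem pow_mul_add_pow_of_mul_pow_eq_zero {x y : S} {m : ℕ} (h : x * y ^ m = 0) (k : ℕ) :
    y ^ m * (x + y) ^ k = y ^ (m + k) := by
  induction k with
  | zero => simp
  | succ k ih => linear_combination (x + y) * ih + y ^ k * h

theorem sq_mul_add_pow_of_cube_eq_zero {x : S} (hx : x ^ 3 = 0) (y : S) (n : ℕ) :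
    x ^ 2 * (x + y) ^ n = x ^ 2 * y ^ n := by
  induction n with
  | zero => simp
  | succ n ih => linear_combination (x + y) * ih + y ^ n * hx

theorem pow_mul_pow_mul_add_pow_eq_zero {u v : S} {d : ℕ}
    (h : ∀ i j, i + j = d → u ^ i * v ^ j = 0) (k : ℕ) :
    ∀ i j, i + j + k = d → u ^ i * v ^ j * (u + v) ^ k = 0 := by
  induction k with
  | zero => intro i j hij; simpa using h i j hij
  | succ k ih =>
    intro i j hij
    linear_combination ih (i + 1) j (by omega) + ih i (j + 1) (by omega)

/-- When `x ^ 3 = 0` and `z = x + y`, only three monomials have to be checked. -/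
theorem monomials_eq_zero_of_cube_eq_zero {x y z : S} {d n : ℕ} (hd : d = n + 2)
    (hL : z = x + y) (hx : x ^ 3 = 0) (h0 : y ^ (n + 2) = 0) (h1 : x * y ^ (n + 1) = 0)
    (h2 : x ^ 2 * y ^ n = 0) (i j k : ℕ) (hijk : i + j + k = d) : x ^ i * y ^ j * z ^ k = 0 := by
  subst hL hd
  refine pow_mul_pow_mul_add_pow_eq_zero (d := n + 2) (fun i j hij => ?_) k i j hijk
  match i with
  | 0 => obtain rfl : j = n + 2 := by omega
         simpa using h0
  | 1 => obtain rfl : j = n + 1 := by omega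
         simpa using h1
  | 2 => obtain rfl : j = n := by omega
         exact h2
  | i + 3 => rw [pow_add, hx]; simp

theorem WLPRelations.swap {a b c α β γ : ℕ} {x y z : S} (h : WLPRelations a b c α β γ x y z) :
    WLPRelations c b a γ β α z y x where
  hx := h.hz
  hy := by rw [h.hy, mul_comm]
  hz := h.hx
  hxy := by rw [mul_comm, h.hyz]
  hyz := by rw [mul_comm, h.hxy]

end Vanishing

theorem VanishesModLinear.swap {K : Type*} [Field K] {a b c α β γ d : ℕ}
    (h : VanishesModLinear K a b c α β γ d) : VanishesModLinear K c b a γ β α d := by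
  obtain ⟨p, q, r, h⟩ := h
  refine ⟨r, q, p, fun S _ _ x y z hrel hL i j k hijk => ?_⟩
  have := h S z y x hrel.swap (by rw [← hL]; abel) k j i (by omega)
  linear_combination this

theorem vanishesModLinear_of_a_eq_two (K : Type*) [Field K] [CharZero K] {b c β γ : ℕ}
    (hβ1 : 1 ≤ β) (hβ2 : β ≤ b - 1) (hγ1 : 1 ≤ γ) (hγ2 : γ ≤ c - 1) (hαγ : 1 + γ = b) :
    VanishesModLinear K 2 b c 1 β γ ((2 + b + c - β - 3) / 2 + 1) := by
  refine ⟨1, 1, -1, fun S _ _ x y z ⟨hx, hy, hz, hxy, hyz⟩ hL => ?_⟩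
  have hL : z = x + y := by
    simp only [one_smul, neg_smul] at hL
    linear_combination -hL
  obtain ⟨m, hm⟩ : ∃ m, m = b - β := ⟨_, rfl⟩
  obtain ⟨k, hk⟩ : ∃ k, k = c - γ := ⟨_, rfl⟩
  obtain ⟨n, hn⟩ : ∃ n, (2 + b + c - β - 3) / 2 + 1 = n + 2 :=
    ⟨(2 + b + c - β - 3) / 2 - 1, by omega⟩
  rw [← hm, ← hk, hL] at hyz
  rw [← hm] at hxy
  norm_num at hxy
  rw [pow_mul_add_pow_of_mul_pow_eq_zero hxy] at hyz
  have hx3 : x ^ 3 = 0 := by linear_combination x * hx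
  have h1 : ∀ j, m ≤ j → x * y ^ j = 0 := fun j hj => by
    simpa using pow_mul_pow_eq_zero_of_le (u := x) (m := 1) (m' := 1) (by simpa using hxy) le_rfl hj
  have hyb : y ^ b = 0 := by
    obtain ⟨g, rfl⟩ : ∃ g, γ = g + 1 := ⟨γ - 1, by omega⟩
    rw [hy, hL, pow_one, mul_add_pow_of_cube_eq_zero hx3, h1 _ (by omega), hx]
    simp
  refine monomials_eq_zero_of_cube_eq_zero hn hL hx3 ?_ (h1 _ (by omega)) (by simp [hx])
  rcases le_total b (m + k) with h | h
  · exact pow_eq_zero_of_le (by omega) hyb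
  · exact pow_eq_zero_of_le (by omega) hyz

theorem vanishesModLinear_of_a_eq_three_of_α_eq_two (K : Type*) [Field K] [CharZero K]
    {b c β γ : ℕ} (hβ1 : 1 ≤ β) (hβ2 : β ≤ b - 1) (hγ1 : 1 ≤ γ) (hγ2 : γ ≤ c - 1)
    (hαγ : 2 + γ = b) :
    VanishesModLinear K 3 b c 2 β γ ((3 + b + c - β - 3) / 2 + 1) := by
  refine ⟨1, 1, -1, fun S _ _ x y z ⟨hx, hy, hz, hxy, hyz⟩ hL => ?_⟩
  have hL : z = x + y := by
    simp only [one_smul, neg_smul] at hL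
    linear_combination -hL
  obtain ⟨m, hm⟩ : ∃ m, m = b - β := ⟨_, rfl⟩
  obtain ⟨k, hk⟩ : ∃ k, k = c - γ := ⟨_, rfl⟩
  obtain ⟨n, hn⟩ : ∃ n, (3 + b + c - β - 3) / 2 + 1 = n + 2 :=
    ⟨(3 + b + c - β - 3) / 2 - 1, by omega⟩
  rw [← hm, ← hk, hL] at hyz
  rw [← hm] at hxy
  norm_num at hxy
  rw [pow_mul_add_pow_of_mul_pow_eq_zero hxy] at hyz
  rw [hL, sq_mul_add_pow_of_cube_eq_zero hx] at hy
  have h1 : x * y ^ (n + 1) = 0 := by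
    simpa using pow_mul_pow_eq_zero_of_le (u := x) (m := 1) (m' := 1) (by simpa using hxy) le_rfl
      (show m ≤ n + 1 by omega)
  have hyb : b ≤ n + 2 → y ^ (n + 2) = x ^ 2 * y ^ n := fun hb => by
    obtain ⟨s, rfl⟩ : ∃ s, n = γ + s := ⟨n - γ, by omega⟩
    rw [← hαγ] at hy
    linear_combination y ^ s * hy
  have hyk : m + k ≤ n + 2 → y ^ (n + 2) = 0 := fun h => pow_eq_zero_of_le h hyz
  suffices h : y ^ (n + 2) = 0 ∧ x ^ 2 * y ^ n = 0 from
    monomials_eq_zero_of_cube_eq_zero hn hL hx h.1 h1 h.2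
  rcases Nat.lt_or_ge (m + 1) c with hc | hc
  · have h2 : x ^ 2 * y ^ n = 0 :=
      pow_mul_pow_eq_zero_of_le (m := 1) (by simpa using hxy) (by omega) (by omega)
    refine ⟨?_, h2⟩
    rcases Nat.le_total b (m + k) with h | h
    · rw [hyb (by omega), h2]
    · exact hyk (by omega)
  · rcases Nat.lt_or_ge c (m + 1) with hc' | hc'
    · have h0 := hyk (by omega)
      exact ⟨h0, by rw [← hyb (by omega), h0]⟩
    · have hz' : 2 * (x + y) ^ (n + 2) = 0 := by
        rw [← hL, show n + 2 = c by omega, hz, mul_zero]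
      rw [two_mul_add_pow_of_cube_eq_zero hx, h1] at hz'
      rcases Nat.lt_or_ge b (m + 2) with hb | hb
      · have h0 := hyb (by omega)
        have h2 : x ^ 2 * y ^ n = 0 :=
          eq_zero_of_natCast_mul_eq_zero K (n := 2 + (n + 2) * (n + 1)) (by positivity) (by
            push_cast
            linear_combination hz' - 2 * h0)
        exact ⟨by rw [h0, h2], h2⟩
      · have h0 := hyk (by omega)
        exact ⟨h0, eq_zero_of_natCast_mul_eq_zero K (n := (n + 2) * (n + 1)) (by positivity) (by
            push_cast
            linear_combination hz' - 2 * h0)⟩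

theorem vanishesModLinear_of_a_eq_three_of_α_eq_one (K : Type*) [Field K] [CharZero K]
    {b c β γ : ℕ} (hβ1 : 1 ≤ β) (hβ2 : β ≤ b - 1) (hγ1 : 1 ≤ γ) (hγ2 : γ ≤ c - 1)
    (hαγ : 1 + γ = b) :
    VanishesModLinear K 3 b c 1 β γ ((3 + b + c - β - 3) / 2 + 1) := by
  refine ⟨1, 1, -1, fun S _ _ x y z ⟨hx, hy, hz, hxy, hyz⟩ hL => ?_⟩
  have hL : z = x + y := by
    simp only [one_smul, neg_smul] at hL
    linear_combination -hL
  obtain ⟨m, hm⟩ : ∃ m, m = b - β := ⟨_, rfl⟩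
  obtain ⟨k, hk⟩ : ∃ k, c - γ = k + 1 := ⟨c - γ - 1, by omega⟩
  obtain ⟨g, rfl⟩ : ∃ g, γ = g + 1 := ⟨γ - 1, by omega⟩
  obtain ⟨n, hn⟩ : ∃ n, (3 + b + c - β - 3) / 2 + 1 = n + 2 :=
    ⟨(3 + b + c - β - 3) / 2 - 1, by omega⟩
  rw [← hm, hk, hL] at hyz
  rw [← hm] at hxy
  norm_num at hxy
  rw [pow_mul_add_pow_of_sq_mul_pow_eq_zero hxy] at hyz
  rw [hL, pow_one, mul_add_pow_of_cube_eq_zero hx, ← hαγ] at hy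
  suffices h : y ^ (n + 2) = 0 ∧ x * y ^ (n + 1) = 0 ∧ x ^ 2 * y ^ n = 0 from
    monomials_eq_zero_of_cube_eq_zero hn hL hx h.1 h.2.1 h.2.2
  rcases Nat.lt_or_ge (m + 1) c with hc | hc
  · have h2 : x ^ 2 * y ^ n = 0 := pow_mul_pow_eq_zero_of_le hxy le_rfl (by omega)
    have hyb : g ≤ n → y ^ (n + 2) = x * y ^ (n + 1) := fun hg => by
      obtain ⟨s, rfl⟩ := Nat.exists_eq_add_of_le hg
      linear_combination y ^ s * hy + (g + 1) * h2
    have hyk : m + k ≤ n + 1 → y ^ (n + 2) = -(k + 1) * (x * y ^ (n + 1)) := fun hg => by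
      obtain ⟨s, hs⟩ := Nat.exists_eq_add_of_le hg
      rw [show n + 2 = m + k + s + 1 by omega, hs]
      linear_combination y ^ s * hyz
    rcases Nat.lt_or_ge g n with hg | hg
    · have h1 : x * y ^ (n + 1) = 0 := by
        obtain ⟨s, rfl⟩ := Nat.exists_eq_add_of_lt hg
        linear_combination x * y ^ s * hy + h2 + (g + 1) * y ^ g * y ^ s * hx
      exact ⟨by rw [hyb (by omega), h1], h1, h2⟩
    rcases Nat.lt_or_ge (m + k) (n + 1) with hmk | hmk
    · have h1 : x * y ^ (n + 1) = 0 := by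
        obtain ⟨s, hs⟩ := Nat.exists_eq_add_of_lt hmk
        obtain rfl : n = m + k + s := by omega
        linear_combination x * y ^ s * hyz - (k + 1) * h2
      exact ⟨by rw [hyk (by omega), h1, mul_zero], h1, h2⟩
    · have h1 : x * y ^ (n + 1) = 0 :=
        eq_zero_of_natCast_mul_eq_zero K (n := k + 2) (by positivity) (by
          push_cast
          linear_combination hyk (by omega) - hyb (by omega))
      exact ⟨by rw [hyb (by omega), h1], h1, h2⟩
  · obtain rfl : m = n + 1 := by omega
    obtain rfl : g = n := by omega
    obtain rfl : k = 0 := by omega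
    have hz' : 2 * (x + y) ^ (g + 2) = 0 := by
      rw [← hL, show g + 2 = c by omega, hz, mul_zero]
    rw [two_mul_add_pow_of_cube_eq_zero hx] at hz'
    rw [show 1 + (g + 1) = g + 2 by omega] at hy
    simp only [Nat.cast_zero, add_zero, zero_add, one_mul] at hyz
    have hyz : y ^ (g + 2) + x * y ^ (g + 1) = 0 := hyz
    have h2 : x ^ 2 * y ^ g = 0 :=
      eq_zero_of_natCast_mul_eq_zero K (n := g + 1) (by positivity) (by
        push_cast
        linear_combination hz' - (g + 1) * (hyz - hy) - 2 * hyz)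
    have h1 : x * y ^ (g + 1) = 0 :=
      eq_zero_of_natCast_mul_eq_zero K (n := 2) (by positivity) (by
        push_cast
        linear_combination hyz - hy - (g + 1) * h2)
    exact ⟨by linear_combination hyz - h1, h1, h2⟩

theorem vanishesModLinear_of_b_eq_two (K : Type*) [Field K] {a c : ℕ} (ha : 2 ≤ a)
    (hac : a ≤ c) : VanishesModLinear K a 2 c 1 1 1 ((a + 2 + c - 1 - 3) / 2 + 1) := by
  refine ⟨0, 1, -1, fun S _ _ x y z ⟨hx, hy, hz, hxy, hyz⟩ hL => ?_⟩
  obtain rfl : y = z := by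
    simp only [one_smul, neg_smul, zero_smul] at hL
    linear_combination hL
  generalize hd : (a + 2 + c - 1 - 3) / 2 + 1 = d
  norm_num at hxy hy
  intro i j k hijk
  rw [mul_assoc, ← pow_add]
  have key : ∀ j i, x ^ i * y ^ (j + 1) = x ^ (i + j) * y := fun j => by
    induction j with
    | zero => simp
    | succ j ih =>
      intro i
      rw [show i + (j + 1) = (i + 1) + j by omega, ← ih (i + 1)]
      linear_combination x ^ i * y ^ j * hy
  rcases Nat.eq_zero_or_eq_succ_pred (j + k) with h | h
  · rw [pow_eq_zero_of_le (by omega) hx, zero_mul]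
  · rw [h, key]
    simpa using pow_mul_pow_eq_zero_of_le (v := y) (n := 1) (n' := 1) (by simpa using hxy)
      (show a - 1 ≤ i + (j + k).pred by omega) le_rfl

section CubicCuts

variable {S : Type*} [CommRing S] {x y z : S}

theorem pow_mul_pow_eq_of_cube_eq_mul_sq (h : z ^ 3 = x * z ^ 2) (j : ℕ) :
    ∀ i, x ^ i * z ^ (j + 2) = x ^ (i + j) * z ^ 2 := by
  induction j with
  | zero => simp
  | succ j ih =>
    intro i
    rw [show i + (j + 1) = (i + 1) + j by omega, ← ih (i + 1)]
    linear_combination x ^ i * z ^ j * h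

theorem pow_mul_pow_eq_zero_of_cube_eq_mul_sq (h : x ^ 3 = x * z ^ 2) {d : ℕ}
    (h0 : z ^ d = 0) (h1 : x * z ^ (d - 1) = 0) (h2 : x ^ 2 * z ^ (d - 2) = 0) :
    ∀ i j, i + j = d → x ^ i * z ^ j = 0 := by
  intro i
  induction i using Nat.strong_induction_on with
  | _ i ih =>
    intro j hij
    match i with
    | 0 => obtain rfl : j = d := by omega
           simpa using h0
    | 1 => obtain rfl : j = d - 1 := by omega
           simpa using h1
    | 2 => obtain rfl : j = d - 2 := by omega
           exact h2
    | i + 3 => linear_combination x ^ i * z ^ j * h + ih (i + 1) (by omega) (j + 2) (by omega)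

/-- The positivity of the recursion `t ^ 3 = t + 1`, with `t = y / z`. -/
theorem exists_add_pow_eq_of_cube_eq (h : y ^ 3 = (y + z) * z ^ 2) (n : ℕ) :
    ∃ p q r : ℕ, q ≠ 0 ∧
      (y + z) ^ (n + 2) = p * (y ^ 2 * z ^ n) + q * (y * z ^ (n + 1)) + r * z ^ (n + 2) := by
  induction n with
  | zero => exact ⟨1, 2, 1, by norm_num, by push_cast; ring⟩
  | succ n ih =>
    obtain ⟨p, q, r, hq, ih⟩ := ih
    refine ⟨p + q, p + q + r, p + r, by omega, ?_⟩
    push_cast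
    linear_combination (y + z) * ih + p * z ^ n * h

theorem pow_mul_pow_eq_zero_of_cube_eq (K : Type*) [Field K] [CharZero K] [Algebra K S]
    (h : y ^ 3 = (y + z) * z ^ 2) {n : ℕ} (h0 : z ^ (n + 2) = 0) (h2 : y ^ 2 * z ^ n = 0)
    (hyz : (y + z) ^ (n + 2) = 0) : ∀ i j, i + j = n + 2 → y ^ i * z ^ j = 0 := by
  have h1 : y * z ^ (n + 1) = 0 := by
    obtain ⟨p, q, r, hq, hpqr⟩ := exists_add_pow_eq_of_cube_eq h n
    refine eq_zero_of_natCast_mul_eq_zero K hq ?_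
    linear_combination hyz - hpqr - r * h0 - p * h2
  intro i
  induction i using Nat.strong_induction_on with
  | _ i ih =>
    intro j hij
    match i with
    | 0 => obtain rfl : j = n + 2 := by omega
           simpa using h0
    | 1 => obtain rfl : j = n + 1 := by omega
           simpa using h1
    | 2 => obtain rfl : j = n := by omega
           exact h2
    | i + 3 =>
      linear_combination y ^ i * z ^ j * h + ih (i + 1) (by omega) (j + 2) (by omega) +
        ih i (by omega) (j + 3) (by omega)

end CubicCuts

theorem vanishesModLinear_of_b_eq_three (K : Type*) [Field K] [CharZero K] {a c β : ℕ}
    (ha : 2 ≤ a) (hβ1 : 1 ≤ β) (hβ2 : β ≤ 2) (hc : 3 ≤ c) :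
    VanishesModLinear K a 3 c 1 β 2 ((a + 3 + c - β - 3) / 2 + 1) := by
  generalize hd : (a + 3 + c - β - 3) / 2 + 1 = d
  rcases Nat.lt_or_ge c a with hca | hca
  · refine ⟨-1, 1, 0, fun S _ _ x y z ⟨hx, hy, hz, hxy, hyz⟩ hL => ?_⟩
    obtain rfl : y = x := by
      simp only [one_smul, neg_smul, zero_smul] at hL
      linear_combination hL
    intro i j k hijk
    rw [← pow_add]
    rw [pow_one] at hy
    have h2 : y ^ 2 * z ^ (d - 2) = 0 := pow_mul_pow_eq_zero_of_le hyz (by omega) (by omega)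
    refine pow_mul_pow_eq_zero_of_cube_eq_mul_sq hy (pow_eq_zero_of_le (by omega) hz) ?_ h2 _ _ hijk
    rcases Nat.lt_or_ge β 2 with hβ | hβ
    · rw [pow_eq_zero_of_le (by omega) hz, mul_zero]
    · simpa using pow_mul_pow_eq_zero_of_le (m' := 1) (n' := d - 1) hyz (by omega) (by omega)
  by_cases hβa : β = 1 ∧ c = a
  · obtain ⟨rfl, rfl⟩ := hβa
    refine ⟨1, -1, -1, fun S _ _ x y z ⟨hx, hy, hz, hxy, hyz⟩ hL => ?_⟩
    obtain rfl : x = y + z := by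
      simp only [one_smul, neg_smul] at hL
      linear_combination hL
    obtain ⟨n, rfl⟩ : ∃ n, c = n + 2 := ⟨c - 2, by omega⟩
    obtain rfl : d = n + 2 := by omega
    rw [pow_one] at hy
    norm_num at hyz
    intro i j k hijk
    have := pow_mul_pow_mul_add_pow_eq_zero
      (pow_mul_pow_eq_zero_of_cube_eq K hy hz hyz hx) i j k (by omega)
    linear_combination this
  · refine ⟨0, 1, -1, fun S _ _ x y z ⟨hx, hy, hz, hxy, hyz⟩ hL => ?_⟩
    obtain rfl : y = z := by
      simp only [one_smul, neg_smul, zero_smul] at hL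
      linear_combination hL
    intro i j k hijk
    rw [mul_assoc, ← pow_add]
    rw [pow_one] at hy
    rw [← pow_add] at hyz
    generalize hl : j + k = l
    match l with
    | 0 => rw [pow_eq_zero_of_le (by omega) hx, zero_mul]
    | 1 =>
      rcases Nat.lt_or_ge β 2 with hβ | hβ
      · rw [pow_eq_zero_of_le (by omega) hx, zero_mul]
      · exact pow_mul_pow_eq_zero_of_le hxy (by omega) (by omega)
    | l + 2 =>
      rw [pow_mul_pow_eq_of_cube_eq_mul_sq hy]
      by_cases h : a - 1 ≤ i + l
      · exact pow_mul_pow_eq_zero_of_le hxy h (by omega)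
      · have h0 := pow_mul_pow_eq_of_cube_eq_mul_sq hy (i + l) 0
        rw [pow_eq_zero_of_le (by omega) hyz, mul_zero, zero_add] at h0
        exact h0.symm

theorem vanishesModLinear_of_le_three (K : Type*) [Field K] [CharZero K] {a b c α β γ : ℕ}
    (hα1 : 1 ≤ α) (hα2 : α ≤ a - 1) (hβ1 : 1 ≤ β) (hβ2 : β ≤ b - 1) (hγ1 : 1 ≤ γ)
    (hγ2 : γ ≤ c - 1) (hαγ : α + γ = b) (habc : a ≤ 3 ∨ b ≤ 3 ∨ c ≤ 3) :
    VanishesModLinear K a b c α β γ ((a + b + c - β - 3) / 2 + 1) := by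
  have a_le : ∀ {a b c α γ : ℕ}, 1 ≤ α → α ≤ a - 1 → β ≤ b - 1 → 1 ≤ γ → γ ≤ c - 1 →
      α + γ = b → a ≤ 3 → VanishesModLinear K a b c α β γ ((a + b + c - β - 3) / 2 + 1) := by
    intro a b c α γ hα1 hα2 hβ2 hγ1 hγ2 hαγ ha
    obtain ⟨rfl, rfl⟩ | ⟨rfl, rfl⟩ | ⟨rfl, rfl⟩ :
        (a = 2 ∧ α = 1) ∨ (a = 3 ∧ α = 1) ∨ (a = 3 ∧ α = 2) := by omega
    · exact vanishesModLinear_of_a_eq_two K hβ1 hβ2 hγ1 hγ2 hαγ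
    · exact vanishesModLinear_of_a_eq_three_of_α_eq_one K hβ1 hβ2 hγ1 hγ2 hαγ
    · exact vanishesModLinear_of_a_eq_three_of_α_eq_two K hβ1 hβ2 hγ1 hγ2 hαγ
  have hswap : (c + b + a - β - 3) / 2 + 1 = (a + b + c - β - 3) / 2 + 1 := by omega
  rcases habc with ha | hb | hc
  · exact a_le hα1 hα2 hβ2 hγ1 hγ2 hαγ ha
  · obtain ⟨rfl, rfl, rfl⟩ | ⟨rfl, rfl, rfl⟩ | ⟨rfl, rfl, rfl⟩ :
        (b = 2 ∧ α = 1 ∧ γ = 1) ∨ (b = 3 ∧ α = 1 ∧ γ = 2) ∨ (b = 3 ∧ α = 2 ∧ γ = 1) := by omega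
    · obtain rfl : β = 1 := by omega
      rcases Nat.le_total a c with hac | hac
      · exact vanishesModLinear_of_b_eq_two K (by omega) hac
      · exact hswap ▸ (vanishesModLinear_of_b_eq_two K (by omega) hac).swap
    · exact vanishesModLinear_of_b_eq_three K (by omega) hβ1 hβ2 (by omega)
    · exact hswap ▸ (vanishesModLinear_of_b_eq_three K (by omega) hβ1 hβ2 (by omega)).swap
  · exact hswap ▸ (a_le hγ1 hγ2 hβ2 hα1 hα2 (by omega) hc).swap

section Duality

variable (K : Type*) [Field K] (a b c α β γ : ℕ)

/-- The ideal of the theorem. -/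
noncomputable def wlpIdeal : Ideal (MvPolynomial (Fin 3) K) :=
  Ideal.span {(X 0 : MvPolynomial (Fin 3) K) ^ a,
      X 1 ^ b - X 0 ^ α * X 2 ^ γ, X 2 ^ c,
      X 0 ^ (a - α) * X 1 ^ (b - β), X 1 ^ (b - β) * X 2 ^ (c - γ)}

/-- The exponents of the monomials in the Macaulay dual generator of `wlpIdeal`. -/
def IsSocleExponent (m : Fin 3 →₀ ℕ) : Prop :=
  ∃ s, m 0 + s * α + 1 = a ∧ m 1 + β + 1 = (s + 1) * b ∧ m 2 + s * γ + 1 = c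

/-- The exponents of the monomials forming a `K`-basis of the quotient by `wlpIdeal`. -/
def IsBasisExponent (m : Fin 3 →₀ ℕ) : Prop :=
  (m 1 + β < b ∧ m 0 < a ∧ m 2 < c) ∨ (b ≤ m 1 + β ∧ m 1 < b ∧ m 0 + α < a ∧ m 2 + γ < c)

open Classical in
/-- The functional given by pairing with the Macaulay dual generator of `wlpIdeal`. -/
noncomputable def dualFunctional : MvPolynomial (Fin 3) K →ₗ[K] K :=
  (basisMonomials (Fin 3) K).constr K fun m => if IsSocleExponent a b c α β γ m then 1 else 0

variable {K a b c α β γ}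

open Classical in
theorem dualFunctional_monomial (m : Fin 3 →₀ ℕ) (r : K) :
    dualFunctional K a b c α β γ (monomial m r) =
      if IsSocleExponent a b c α β γ m then r else 0 := by
  have h : monomial m r = r • basisMonomials (Fin 3) K m := by
    simp [coe_basisMonomials, smul_monomial]
  rw [h, map_smul, dualFunctional, Module.Basis.constr_basis]
  simp

theorem dualFunctional_monomial_of_not {m : Fin 3 →₀ ℕ} (r : K)
    (hm : ¬ IsSocleExponent a b c α β γ m) :
    dualFunctional K a b c α β γ (monomial m r) = 0 := by
  rw [dualFunctional_monomial, if_neg hm]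

theorem IsSocleExponent.degree_eq (hαγ : α + γ = b) {m : Fin 3 →₀ ℕ}
    (hm : IsSocleExponent a b c α β γ m) : m.degree + β + 3 = a + b + c := by
  obtain ⟨s, h0, h1, h2⟩ := hm
  rw [Finsupp.degree_eq_sum, Fin.sum_univ_three]
  subst hαγ
  nlinarith

theorem dualFunctional_eq_zero_of_isHomogeneous (hαγ : α + γ = b) {f : MvPolynomial (Fin 3) K}
    {n : ℕ} (hf : f.IsHomogeneous n) (hn : n + β + 3 ≠ a + b + c) :
    dualFunctional K a b c α β γ f = 0 := by
  rw [f.as_sum, map_sum]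
  refine Finset.sum_eq_zero fun m hm => dualFunctional_monomial_of_not _ fun hs => hn ?_
  rw [← hs.degree_eq hαγ, ← hf (mem_support_iff.mp hm), Finsupp.degree_eq_weight_one]
  rfl

theorem dualFunctional_eq_zero_of_mem {p : MvPolynomial (Fin 3) K}
    (hp : p ∈ wlpIdeal K a b c α β γ) : dualFunctional K a b c α β γ p = 0 := by
  suffices h : ∀ f, dualFunctional K a b c α β γ (f * p) = 0 by simpa using h 1
  have key : ∀ g : MvPolynomial (Fin 3) K,
      (∀ m r, dualFunctional K a b c α β γ (monomial m r * g) = 0) →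
      ∀ f, dualFunctional K a b c α β γ (f * g) = 0 := by
    intro g hg f
    rw [f.as_sum, Finset.sum_mul, map_sum]
    exact Finset.sum_eq_zero fun m _ => hg m _
  rw [wlpIdeal] at hp
  induction hp using Submodule.span_induction with
  | mem g hg =>
    apply key
    intro m r
    simp only [Set.mem_insert_iff, Set.mem_singleton_iff] at hg
    rcases hg with rfl | rfl | rfl | rfl | rfl
    · simp only [X_pow_eq_monomial, monomial_mul, mul_one]
      apply dualFunctional_monomial_of_not
      rintro ⟨s, h0, h1, h2⟩
      simp at h0
      omega
    · simp only [X_pow_eq_monomial, monomial_mul, mul_one, mul_sub, map_sub,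
        dualFunctional_monomial, sub_eq_zero]
      congr 1
      rw [eq_iff_iff]
      constructor
      · rintro ⟨s, h0, h1, h2⟩
        simp at h0 h1 h2
        obtain ⟨s, rfl⟩ : ∃ t, s = t + 1 := by
          refine Nat.exists_eq_succ_of_ne_zero ?_
          rintro rfl
          omega
        exact ⟨s, by simp; linarith, by simp; linarith, by simp; linarith⟩
      · rintro ⟨s, h0, h1, h2⟩
        simp at h0 h1 h2
        exact ⟨s + 1, by simp; linarith, by simp; linarith, by simp; linarith⟩
    · simp only [X_pow_eq_monomial, monomial_mul, mul_one]
      apply dualFunctional_monomial_of_not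
      rintro ⟨s, h0, h1, h2⟩
      simp at h2
      omega
    · simp only [X_pow_eq_monomial, monomial_mul, mul_one]
      apply dualFunctional_monomial_of_not
      rintro ⟨s, h0, h1, h2⟩
      simp at h0 h1
      rcases s with _ | s
      · omega
      · rw [add_mul] at h0
        omega
    · simp only [X_pow_eq_monomial, monomial_mul, mul_one]
      apply dualFunctional_monomial_of_not
      rintro ⟨s, h0, h1, h2⟩
      simp at h1 h2
      rcases s with _ | s
      · omega
      · rw [add_mul] at h2
        omega
  | zero => simp
  | add x y _ _ hx hy => intro f; rw [mul_add, map_add, hx, hy, add_zero]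
  | smul r x _ hx => intro f; rw [smul_eq_mul, ← mul_assoc, hx]

/-- The complementary exponent of a basis exponent `m`. -/
theorem exists_dual_exponent (hβ2 : β ≤ b - 1) (hα1 : 1 ≤ α) (hα2 : α ≤ a - 1)
    (hγ2 : γ ≤ c - 1) {m : Fin 3 →₀ ℕ} (hm : IsBasisExponent a b c α β γ m) :
    ∃ m' : Fin 3 →₀ ℕ, ∀ n, IsBasisExponent a b c α β γ n →
      (IsSocleExponent a b c α β γ (n + m') ↔ n = m) := by
  have hext : ∀ n : Fin 3 →₀ ℕ, n 0 = m 0 → n 1 = m 1 → n 2 = m 2 → n = m := by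
    intro n h0 h1 h2
    ext i
    fin_cases i <;> assumption
  rcases hm with hm | hm
  · refine ⟨Finsupp.equivFunOnFinite.symm ![a - 1 - m 0, b - β - 1 - m 1, c - 1 - m 2],
      fun n hn => ⟨?_, ?_⟩⟩
    · rintro ⟨s, h0, h1, h2⟩
      simp at h0 h1 h2
      have hs : s = 0 := by
        by_contra hs
        obtain ⟨t, rfl⟩ := Nat.exists_eq_succ_of_ne_zero hs
        have : n 1 < b := by rcases hn with hn | hn <;> omega
        have : (t.succ + 1) * b = t * b + b + b := by rw [Nat.succ_eq_add_one]; ring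
        omega
      subst hs
      exact hext n (by omega) (by omega) (by omega)
    · rintro rfl
      exact ⟨0, by simp; omega, by simp; omega, by simp; omega⟩
  · refine ⟨Finsupp.equivFunOnFinite.symm
      ![a - 1 - α - m 0, 2 * b - β - 1 - m 1, c - 1 - γ - m 2], fun n hn => ⟨?_, ?_⟩⟩
    · rintro ⟨s, h0, h1, h2⟩
      simp at h0 h1 h2
      have : n 1 < b := by rcases hn with hn | hn <;> omega
      match s with
      | 0 => omega
      | 1 => exact hext n (by omega) (by omega) (by omega)
      | s + 2 =>
        have : (s + 2 + 1) * b = s * b + b + b + b := by ring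
        omega
    · rintro rfl
      exact ⟨1, by simp; omega, by simp; omega, by simp; omega⟩

theorem exists_basis_representative (hβ1 : 1 ≤ β) (hβ2 : β ≤ b - 1)
    (f : MvPolynomial (Fin 3) K) :
    ∃ g : MvPolynomial (Fin 3) K, f - g ∈ wlpIdeal K a b c α β γ ∧
      ∀ m ∈ g.support, IsBasisExponent a b c α β γ m := by
  have hmon : ∀ j i k : ℕ, ∀ r : K, ∃ g : MvPolynomial (Fin 3) K,
      C r * (X 0 ^ i * X 1 ^ j * X 2 ^ k) - g ∈ wlpIdeal K a b c α β γ ∧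
        ∀ m ∈ g.support, IsBasisExponent a b c α β γ m := by
    intro j
    induction j using Nat.strong_induction_on with
    | _ j ih =>
    intro i k r
    have hzero : ∀ p q : MvPolynomial (Fin 3) K, p ∈ wlpIdeal K a b c α β γ →
        C r * (X 0 ^ i * X 1 ^ j * X 2 ^ k) = q * p → ∃ g : MvPolynomial (Fin 3) K,
        C r * (X 0 ^ i * X 1 ^ j * X 2 ^ k) - g ∈ wlpIdeal K a b c α β γ ∧
          ∀ m ∈ g.support, IsBasisExponent a b c α β γ m := fun p q hp h =>
      ⟨0, by rw [sub_zero, h]; exact Ideal.mul_mem_left _ _ hp, by simp⟩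
    have hgen : ∀ p ∈ ({(X 0 : MvPolynomial (Fin 3) K) ^ a,
        X 1 ^ b - X 0 ^ α * X 2 ^ γ, X 2 ^ c, X 0 ^ (a - α) * X 1 ^ (b - β),
        X 1 ^ (b - β) * X 2 ^ (c - γ)} : Set _), p ∈ wlpIdeal K a b c α β γ :=
      fun p hp => Ideal.subset_span hp
    rcases Nat.lt_or_ge j b with hj | hj
    · by_cases hb : IsBasisExponent a b c α β γ (Finsupp.equivFunOnFinite.symm ![i, j, k])
      · refine ⟨monomial (Finsupp.equivFunOnFinite.symm ![i, j, k]) r, ?_, fun m hm => ?_⟩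
        · rw [monomial_eq, Finsupp.prod_fintype _ _ (by simp)]
          simp [Fin.prod_univ_three]
        · obtain rfl := Finset.mem_singleton.mp (support_monomial_subset hm)
          exact hb
      · have hb : ¬ ((j + β < b ∧ i < a ∧ k < c) ∨
            (b ≤ j + β ∧ j < b ∧ i + α < a ∧ k + γ < c)) := hb
        obtain h | h | h | h : a ≤ i ∨ c ≤ k ∨ (a - α ≤ i ∧ b - β ≤ j) ∨
            (b - β ≤ j ∧ c - γ ≤ k) := by omega
        · obtain ⟨s, rfl⟩ := Nat.exists_eq_add_of_le h
          exact hzero _ (C r * (X 0 ^ s * X 1 ^ j * X 2 ^ k)) (hgen (X 0 ^ a) (by simp)) (by ring)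
        · obtain ⟨s, rfl⟩ := Nat.exists_eq_add_of_le h
          exact hzero _ (C r * (X 0 ^ i * X 1 ^ j * X 2 ^ s)) (hgen (X 2 ^ c) (by simp)) (by ring)
        · obtain ⟨s, hs⟩ := Nat.exists_eq_add_of_le h.1
          obtain ⟨t, ht⟩ := Nat.exists_eq_add_of_le h.2
          exact hzero _ (C r * (X 0 ^ s * X 1 ^ t * X 2 ^ k))
            (hgen (X 0 ^ (a - α) * X 1 ^ (b - β)) (by simp)) (by rw [hs, ht]; ring)
        · obtain ⟨s, hs⟩ := Nat.exists_eq_add_of_le h.1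
          obtain ⟨t, ht⟩ := Nat.exists_eq_add_of_le h.2
          exact hzero _ (C r * (X 0 ^ i * X 1 ^ s * X 2 ^ t))
            (hgen (X 1 ^ (b - β) * X 2 ^ (c - γ)) (by simp)) (by rw [hs, ht]; ring)
    · obtain ⟨s, rfl⟩ := Nat.exists_eq_add_of_le hj
      rcases Nat.eq_zero_or_pos b with rfl | hb
      · omega
      obtain ⟨g, hg, hgs⟩ := ih s (by omega) (i + α) (k + γ) r
      refine ⟨g, ?_, hgs⟩
      have := Ideal.add_mem _ hg (Ideal.mul_mem_left _ (C r * (X 0 ^ i * X 1 ^ s * X 2 ^ k))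
        (hgen (X 1 ^ b - X 0 ^ α * X 2 ^ γ) (by simp)))
      convert this using 1
      ring
  induction f using MvPolynomial.induction_on' with
  | monomial m r =>
    obtain ⟨g, hg, hgs⟩ := hmon (m 1) (m 0) (m 2) r
    refine ⟨g, ?_, hgs⟩
    rwa [monomial_eq, Finsupp.prod_fintype _ _ (by simp), Fin.prod_univ_three]
  | add p q hp hq =>
    classical
    obtain ⟨g, hg, hgs⟩ := hp
    obtain ⟨h, hh, hhs⟩ := hq
    refine ⟨g + h, ?_, fun m hm => ?_⟩
    · rw [add_sub_add_comm]
      exact Ideal.add_mem _ hg hh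
    · rcases Finset.mem_union.mp (support_add hm) with hm | hm
      · exact hgs m hm
      · exact hhs m hm

/-- The pairing induced by `dualFunctional` on the quotient by `wlpIdeal` is nondegenerate. -/
theorem mem_wlpIdeal_of_dualFunctional_mul_eq_zero (hα1 : 1 ≤ α) (hα2 : α ≤ a - 1) (hβ1 : 1 ≤ β)
    (hβ2 : β ≤ b - 1) (hγ2 : γ ≤ c - 1) {f : MvPolynomial (Fin 3) K}
    (hf : ∀ m, dualFunctional K a b c α β γ (f * monomial m 1) = 0) :
    f ∈ wlpIdeal K a b c α β γ := by
  obtain ⟨g, hg, hgs⟩ := exists_basis_representative hβ1 hβ2 f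
  suffices h : g = 0 by simpa [h] using hg
  by_contra h0
  obtain ⟨m, hm⟩ := support_nonempty.mpr h0
  obtain ⟨m', hm'⟩ := exists_dual_exponent hβ2 hα1 hα2 hγ2 (hgs m hm)
  have h1 : dualFunctional K a b c α β γ (g * monomial m' 1) = 0 := by
    have h2 := dualFunctional_eq_zero_of_mem
      (Ideal.mul_mem_right (monomial m' 1) _ hg)
    rwa [sub_mul, map_sub, hf, zero_sub, neg_eq_zero] at h2
  rw [g.as_sum, Finset.sum_mul, map_sum, Finset.sum_eq_single m] at h1
  · rw [monomial_mul, mul_one, dualFunctional_monomial, if_pos ((hm' m (hgs m hm)).mpr rfl)] at h1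
    exact mem_support_iff.mp hm h1
  · intro n hn hnm
    rw [monomial_mul]
    exact dualFunctional_monomial_of_not _ fun hs => hnm ((hm' n (hgs n hn)).mp hs)
  · exact fun h => absurd hm h

attribute [local instance] MvPolynomial.gradedAlgebra

theorem wlpIdeal_isHomogeneous (hαγ : α + γ = b) :
    (wlpIdeal K a b c α β γ).IsHomogeneous (homogeneousSubmodule (Fin 3) K) := by
  refine Ideal.homogeneous_span _ _ fun p hp => ?_
  have hX : ∀ (i : Fin 3) n, ((X i : MvPolynomial (Fin 3) K) ^ n).IsHomogeneous n :=
    fun i n => isHomogeneous_X_pow i n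
  simp only [Set.mem_insert_iff, Set.mem_singleton_iff] at hp
  rcases hp with rfl | rfl | rfl | rfl | rfl
  · exact ⟨_, hX _ _⟩
  · exact ⟨b, (hX 1 b).sub (hαγ ▸ (hX 0 α).mul (hX 2 γ))⟩
  · exact ⟨_, hX _ _⟩
  · exact ⟨_, (hX _ _).mul (hX _ _)⟩
  · exact ⟨_, (hX _ _).mul (hX _ _)⟩

/-- In a homogeneous ideal plus a linear form, homogeneous elements split homogeneously. -/
theorem exists_isHomogeneous_sub_mul_mem {I : Ideal (MvPolynomial (Fin 3) K)}
    (hI : I.IsHomogeneous (homogeneousSubmodule (Fin 3) K)) {L w : MvPolynomial (Fin 3) K} {n : ℕ}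
    (hL : L.IsHomogeneous 1) (hw : w.IsHomogeneous (n + 1)) (h : w ∈ I ⊔ Ideal.span {L}) :
    ∃ u : MvPolynomial (Fin 3) K, u.IsHomogeneous n ∧ w - L * u ∈ I := by
  obtain ⟨p, hp, q, hq, rfl⟩ := Submodule.mem_sup.mp h
  obtain ⟨g, rfl⟩ := Ideal.mem_span_singleton'.mp hq
  refine ⟨homogeneousComponent n g, homogeneousComponent_isHomogeneous n g, ?_⟩
  have h1 := homogeneousComponent_mem_of_mem hI hp (n + 1)
  have h2 : homogeneousComponent (n + 1) (g * L) = homogeneousComponent n g * L := by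
    have := DirectSum.coe_decompose_mul_add_of_right_mem (homogeneousSubmodule (Fin 3) K)
      (i := n) (j := 1) (a := g) (b := L) hL
    rw [← decomposition.decompose'_apply, ← decomposition.decompose'_apply]
    exact this
  have h3 := homogeneousComponent_eq_self hw
  rw [map_add, h2] at h3
  rw [← h3]
  convert h1 using 1
  ring

theorem hasWLP_of_vanishesModLinear {K : Type*} [Field K] {a b c α β γ : ℕ} (hα1 : 1 ≤ α)
    (hα2 : α ≤ a - 1) (hβ1 : 1 ≤ β) (hβ2 : β ≤ b - 1) (hγ2 : γ ≤ c - 1)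
    (hαγ : α + γ = b)
    (h : VanishesModLinear K a b c α β γ ((a + b + c - β - 3) / 2 + 1)) :
    hasWLP K (wlpIdeal K a b c α β γ) := by
  obtain ⟨p, q, r, h⟩ := h
  generalize hd : (a + b + c - β - 3) / 2 + 1 = d at h
  set I := wlpIdeal K a b c α β γ
  set L : MvPolynomial (Fin 3) K := p • X 0 + q • X 1 + r • X 2
  have hL : L ∈ homogeneousSubmodule (Fin 3) K 1 :=
    Submodule.add_mem _ (Submodule.add_mem _ (Submodule.smul_mem _ _ (isHomogeneous_X K 0))
      (Submodule.smul_mem _ _ (isHomogeneous_X K 1))) (Submodule.smul_mem _ _ (isHomogeneous_X K 2))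
  set J := I ⊔ Ideal.span {L}
  have hmon : ∀ i j k : ℕ, d ≤ i + j + k →
      (X 0 ^ i * X 1 ^ j * X 2 ^ k : MvPolynomial (Fin 3) K) ∈ J := by
    have hIJ : ∀ f ∈ ({(X 0 : MvPolynomial (Fin 3) K) ^ a,
        X 1 ^ b - X 0 ^ α * X 2 ^ γ, X 2 ^ c, X 0 ^ (a - α) * X 1 ^ (b - β),
        X 1 ^ (b - β) * X 2 ^ (c - γ)} : Set _), Ideal.Quotient.mk J f = 0 := fun f hf =>
      Ideal.Quotient.eq_zero_iff_mem.mpr (le_sup_left (a := I) (Ideal.subset_span hf))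
    have hLJ : Ideal.Quotient.mk J L = 0 := Ideal.Quotient.eq_zero_iff_mem.mpr
      (le_sup_right (a := I) (Ideal.mem_span_singleton_self L))
    have hrel : WLPRelations a b c α β γ (Ideal.Quotient.mk J (X 0)) (Ideal.Quotient.mk J (X 1))
        (Ideal.Quotient.mk J (X 2)) :=
      ⟨by simpa using hIJ (X 0 ^ a) (by simp),
        by
          rw [← sub_eq_zero, ← map_pow, ← map_pow, ← map_pow, ← map_mul, ← map_sub]
          exact hIJ _ (by simp),
        by simpa using hIJ (X 2 ^ c) (by simp),
        by rw [← map_pow, ← map_pow, ← map_mul]; exact hIJ _ (by simp),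
        by rw [← map_pow, ← map_pow, ← map_mul]; exact hIJ _ (by simp)⟩
    have hzero := h (MvPolynomial (Fin 3) K ⧸ J) _ _ _ hrel hLJ
    intro i j k hijk
    obtain ⟨i', j', k', hi, hj, hk, hd'⟩ :
        ∃ i' j' k', i' ≤ i ∧ j' ≤ j ∧ k' ≤ k ∧ i' + j' + k' = d :=
      ⟨min i d, min j (d - min i d), d - min i d - min j (d - min i d),
        by omega, by omega, by omega, by omega⟩
    have h1 : (X 0 ^ i' * X 1 ^ j' * X 2 ^ k' : MvPolynomial (Fin 3) K) ∈ J :=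
      Ideal.Quotient.eq_zero_iff_mem.mp (by simpa using hzero i' j' k' hd')
    exact Ideal.mem_of_dvd J (mul_dvd_mul (mul_dvd_mul (pow_dvd_pow _ hi) (pow_dvd_pow _ hj))
      (pow_dvd_pow _ hk)) h1
  have hmonomial : ∀ (m : Fin 3 →₀ ℕ) (s : K), d ≤ m.degree → monomial m s ∈ J := by
    intro m s hm
    rw [monomial_eq, Finsupp.prod_fintype _ _ (by simp), Fin.prod_univ_three]
    refine Ideal.mul_mem_left _ _ (hmon _ _ _ ?_)
    rwa [Finsupp.degree_eq_sum, Fin.sum_univ_three] at hm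
  refine ⟨L, hL, fun n => ?_⟩
  rcases Nat.lt_or_ge (n + 1) d with hn | hn
  · left
    suffices hinj : ∀ f : MvPolynomial (Fin 3) K, f.IsHomogeneous n → L * f ∈ I → f ∈ I by
      rintro _ ⟨f, hf, rfl⟩ _ ⟨g, hg, rfl⟩ hfg
      simp only [AlgHom.toLinearMap_apply, Ideal.Quotient.mkₐ_eq_mk, ← map_mul,
        Ideal.Quotient.eq] at hfg ⊢
      exact hinj _ (IsHomogeneous.sub hf hg) (by rwa [mul_sub])
    intro f hf hLf
    refine mem_wlpIdeal_of_dualFunctional_mul_eq_zero hα1 hα2 hβ1 hβ2 hγ2 fun m => ?_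
    by_cases hm : n + m.degree + β + 3 = a + b + c
    · obtain ⟨p, hp, q, hq, hpq⟩ := Submodule.mem_sup.mp (hmonomial m 1 (by omega))
      obtain ⟨g, rfl⟩ := Ideal.mem_span_singleton'.mp hq
      refine dualFunctional_eq_zero_of_mem ?_
      rw [← hpq, show f * (p + g * L) = f * p + g * (L * f) by ring]
      exact Ideal.add_mem _ (Ideal.mul_mem_left _ _ hp) (Ideal.mul_mem_left _ _ hLf)
    · exact dualFunctional_eq_zero_of_isHomogeneous hαγ
        (hf.mul (isHomogeneous_monomial 1 rfl)) hm
  · right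
    rintro _ ⟨w, hw, rfl⟩
    have hwJ : w ∈ J := by
      rw [w.as_sum]
      refine Ideal.sum_mem _ fun m hm => hmonomial m _ ?_
      have : m.degree = n + 1 := by
        rw [← hw (mem_support_iff.mp hm), Finsupp.degree_eq_weight_one]
        rfl
      omega
    obtain ⟨u, hu, huw⟩ :=
      exists_isHomogeneous_sub_mul_mem (wlpIdeal_isHomogeneous hαγ) hL hw hwJ
    refine ⟨Ideal.Quotient.mk I u, ⟨u, hu, rfl⟩, ?_⟩
    simp only [AlgHom.toLinearMap_apply, Ideal.Quotient.mkₐ_eq_mk, ← map_mul]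
    exact (Ideal.Quotient.eq.mpr huw).symm

end Duality

theorem stmt_0 (K : Type*) [Field K] [CharZero K] (a b c α β γ : ℕ)
    (hα1 : 1 ≤ α) (hα2 : α ≤ a - 1)
    (hβ1 : 1 ≤ β) (hβ2 : β ≤ b - 1)
    (hγ1 : 1 ≤ γ) (hγ2 : γ ≤ c - 1)
    (hαγ : α + γ = b)
    (habc : a ≤ 3 ∨ b ≤ 3 ∨ c ≤ 3) :
    hasWLP K (Ideal.span {(X 0 : MvPolynomial (Fin 3) K) ^ a,
      X 1 ^ b - X 0 ^ α * X 2 ^ γ, X 2 ^ c,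
      X 0 ^ (a - α) * X 1 ^ (b - β), X 1 ^ (b - β) * X 2 ^ (c - γ)}) := by
  exact hasWLP_of_vanishesModLinear hα1 hα2 hβ1 hβ2 hγ2 hαγ
    (vanishesModLinear_of_le_three K hα1 hα2 hβ1 hβ2 hγ1 hγ2 hαγ habc)
end

section
/- Let K be a field of characteristic zero, R = K[x,y,z], and let a, b, β be integers with b ≤ a ≤ 2b−3 and a−b+2 ≤ β ≤ b−1. Then the quotient of R by the ideal I_β = (x^a, y^b − x^{b−1} z, z^2, x^{a−b+1} y^{b−β}, y^{b−β} z) has the weak Lefschetz property. -/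
open MvPolynomial

/-- If the coefficients of `(X i + X j) * f` vanish on a set of exponents stable under adding
`i` and under removing `j`, then so do the coefficients of `f`. -/
lemma coeff_eq_zero_of_X_add_X_mul {σ R : Type*} [CommRing R] {i j : σ} (hij : i ≠ j)
    {S : Set (σ →₀ ℕ)} (hi : ∀ m ∈ S, m + Finsupp.single i 1 ∈ S)
    (hj : ∀ m, m + Finsupp.single j 1 ∈ S → m ∈ S) {f : MvPolynomial σ R}
    (hf : ∀ m ∈ S, coeff m ((X i + X j) * f) = 0) : ∀ m ∈ S, coeff m f = 0 := by
  classical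
  suffices h : ∀ n, ∀ m ∈ S, m j = n → coeff m f = 0 from fun m hm => h _ m hm rfl
  intro n
  induction n with
  | zero =>
    intro m hm hn
    have h := hf _ (hi m hm)
    rw [add_mul, coeff_add, mul_comm, coeff_mul_X, mul_comm, coeff_mul_X',
      if_neg (by simp [hn, hij]), add_zero] at h
    exact h
  | succ n ih =>
    intro m hm hn
    obtain ⟨m, rfl⟩ : ∃ m', m = m' + Finsupp.single j 1 :=
      ⟨m - Finsupp.single j 1, (tsub_add_cancel_of_le (by simp [hn])).symm⟩
    have h := hf _ (hi _ hm)
    rw [add_mul, coeff_add, mul_comm, coeff_mul_X, add_right_comm, mul_comm (X j),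
      coeff_mul_X, ih _ (hi m (hj m hm)) (by simpa [hij.symm, hij] using hn), add_zero] at h
    exact h

lemma monomial_fin_three {R : Type*} [CommSemiring R] (m : Fin 3 →₀ ℕ) (r : R) :
    monomial m r = C r * (X 0 ^ m 0 * X 1 ^ m 1 * X 2 ^ m 2) := by
  rw [monomial_eq, Finsupp.prod_fintype _ _ (by simp), Fin.prod_univ_three]

lemma degree_fin_three (m : Fin 3 →₀ ℕ) : m.degree = m 0 + m 1 + m 2 := by
  rw [Finsupp.degree_eq_sum, Fin.sum_univ_three]

/-- The ideal `(x^a, y^b - x^(b-1) z, z^2, x^d y^c, y^c z)`. -/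
noncomputable def lefschetzIdeal (K : Type*) [Field K] (a b c d : ℕ) :
    Ideal (MvPolynomial (Fin 3) K) :=
  Ideal.span {X 0 ^ a, X 1 ^ b - X 0 ^ (b - 1) * X 2, X 2 ^ 2, X 0 ^ d * X 1 ^ c, X 1 ^ c * X 2}

section

variable {K : Type*} [Field K] {a b c d : ℕ}

lemma X_pow_mul_mem_lefschetzIdeal {p q r : ℕ}
    (h : 2 ≤ r ∨ (d ≤ p ∧ c ≤ q) ∨ (c ≤ q ∧ 1 ≤ r)) :
    (X 0 ^ p * X 1 ^ q * X 2 ^ r : MvPolynomial (Fin 3) K) ∈ lefschetzIdeal K a b c d := by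
  rcases h with h | ⟨hp, hq⟩ | ⟨hq, hr⟩
  · exact Ideal.mem_of_dvd _ ((pow_dvd_pow _ h).mul_left _)
      (Ideal.subset_span (by simp))
  · exact Ideal.mem_of_dvd _ ((mul_dvd_mul (pow_dvd_pow _ hp) (pow_dvd_pow _ hq)).mul_right _)
      (Ideal.subset_span (by simp))
  · rw [mul_assoc]
    exact Ideal.mem_of_dvd _
      ((mul_dvd_mul (pow_dvd_pow _ hq) (dvd_pow_self _ (by omega))).mul_left _)
      (Ideal.subset_span (by simp))

/-- Exponents occurring in `lefschetzIdeal` in degrees below `b` are those of the monomial ideal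
`(z^2, x^d y^c, y^c z)`. -/
lemma exponent_of_mem_lefschetzIdeal (hba : b ≤ a) {f : MvPolynomial (Fin 3) K}
    (hf : f ∈ lefschetzIdeal K a b c d) {m : Fin 3 →₀ ℕ} (hm : coeff m f ≠ 0)
    (hdeg : m.degree < b) :
    2 ≤ m 2 ∨ (d ≤ m 0 ∧ c ≤ m 1) ∨ (c ≤ m 1 ∧ 1 ≤ m 2) := by
  classical
  let P : Set (Fin 3 →₀ ℕ) :=
    {m | b ≤ m.degree ∨ 2 ≤ m 2 ∨ (d ≤ m 0 ∧ c ≤ m 1) ∨ (c ≤ m 1 ∧ 1 ≤ m 2)}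
  have hmem : ∀ p q r : ℕ,
      (b ≤ p + q + r ∨ 2 ≤ r ∨ (d ≤ p ∧ c ≤ q) ∨ (c ≤ q ∧ 1 ≤ r)) →
      (X 0 ^ p * X 1 ^ q * X 2 ^ r : MvPolynomial (Fin 3) K) ∈
        Ideal.span ((fun s => monomial s (1 : K)) '' P) := by
    intro p q r h
    refine Ideal.subset_span ⟨Finsupp.equivFunOnFinite.symm ![p, q, r], ?_, ?_⟩
    · simpa [P, degree_fin_three] using h
    · simp [monomial_fin_three]
  have hle : lefschetzIdeal K a b c d ≤ Ideal.span ((fun s => monomial s (1 : K)) '' P) := by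
    rw [lefschetzIdeal, Ideal.span_le]
    rintro g (rfl | rfl | rfl | rfl | rfl)
    · simpa using hmem a 0 0 (by omega)
    · exact sub_mem (by simpa using hmem 0 b 0 (by omega))
        (by simpa using hmem (b - 1) 0 1 (by omega))
    · simpa using hmem 0 0 2 (by omega)
    · simpa using hmem d c 0 (by omega)
    · simpa using hmem 0 c 1 (by omega)
  obtain ⟨s, hs, hsm⟩ := mem_ideal_span_monomial_image.mp (hle hf) m (mem_support_iff.mpr hm)
  have h0 := hsm 0
  have h1 := hsm 1
  have h2 := hsm 2
  rw [degree_fin_three] at hdeg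
  simp only [P, Set.mem_ofPred_eq, degree_fin_three] at hs
  omega

lemma mem_lefschetzIdeal_of_X_add_X_mul_mem (hba : b ≤ a) {n : ℕ} (hn : n + 1 < b)
    {f : MvPolynomial (Fin 3) K} (hf : f.IsHomogeneous n)
    (h : (X 0 + X 1) * f ∈ lefschetzIdeal K a b c d) : f ∈ lefschetzIdeal K a b c d := by
  have hL : ((X 0 + X 1) * f).IsHomogeneous (n + 1) := by
    rw [add_comm n]
    exact ((isHomogeneous_X K 0).add (isHomogeneous_X K 1)).mul hf
  have hexp : ∀ m, coeff m ((X 0 + X 1) * f) ≠ 0 →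
      2 ≤ m 2 ∨ (d ≤ m 0 ∧ c ≤ m 1) ∨ (c ≤ m 1 ∧ 1 ≤ m 2) := fun m hm =>
    exponent_of_mem_lefschetzIdeal hba h hm (by
      rwa [show m.degree = n + 1 from by
        by_contra hne
        exact hm (hL.coeff_eq_zero hne)])
  have h1 : ∀ m ∈ {m : Fin 3 →₀ ℕ | m 2 < 2 ∧ m 1 < c}, coeff m f = 0 := by
    refine coeff_eq_zero_of_X_add_X_mul (i := 0) (j := 1) (by decide) ?_ ?_ ?_
    · intro m hm
      simpa using hm
    · rintro m ⟨hm, hm'⟩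
      simp at hm hm'
      exact ⟨by omega, by omega⟩
    · rintro m ⟨hm, hm'⟩
      by_contra hne
      have := hexp m hne
      omega
  have h2 : ∀ m ∈ {m : Fin 3 →₀ ℕ | m 2 < 1 ∧ m 0 < d}, coeff m f = 0 := by
    refine coeff_eq_zero_of_X_add_X_mul (i := 1) (j := 0) (by decide) ?_ ?_ ?_
    · intro m hm
      simpa using hm
    · rintro m ⟨hm, hm'⟩
      simp at hm hm'
      exact ⟨by omega, by omega⟩
    · rintro m ⟨hm, hm'⟩
      by_contra hne
      rw [add_comm] at hne
      have := hexp m hne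
      omega
  rw [f.as_sum]
  refine sum_mem fun m hm => ?_
  rw [mem_support_iff] at hm
  rw [monomial_fin_three]
  refine Ideal.mul_mem_left _ _ (X_pow_mul_mem_lefschetzIdeal ?_)
  by_contra hne
  by_cases hS : m 2 < 2 ∧ m 1 < c
  · exact hm (h1 m hS)
  · exact hm (h2 m (by simp only [Set.mem_ofPred_eq]; omega))

lemma homogeneousSubmodule_succ_le {n : ℕ} (hn : c + d ≤ n + 1) (hcn : c ≤ n) :
    homogeneousSubmodule (Fin 3) K (n + 1) ≤
      (lefschetzIdeal K a b c d).restrictScalars K ⊔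
        (homogeneousSubmodule (Fin 3) K n).map (LinearMap.mulLeft K (X 0 + X 1)) := by
  set G := (lefschetzIdeal K a b c d).restrictScalars K ⊔
    (homogeneousSubmodule (Fin 3) K n).map (LinearMap.mulLeft K (X 0 + X 1))
  have hswap : ∀ p q r : ℕ, p + q + r = n →
      ((X 0 ^ (p + 1) * X 1 ^ q * X 2 ^ r : MvPolynomial (Fin 3) K) ∈ G ↔
        (X 0 ^ p * X 1 ^ (q + 1) * X 2 ^ r : MvPolynomial (Fin 3) K) ∈ G) := by
    intro p q r h
    have hmem : (X 0 ^ (p + 1) * X 1 ^ q * X 2 ^ r + X 0 ^ p * X 1 ^ (q + 1) * X 2 ^ r :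
        MvPolynomial (Fin 3) K) ∈ G := by
      refine Submodule.mem_sup_right ⟨X 0 ^ p * X 1 ^ q * X 2 ^ r, ?_, ?_⟩
      · rw [← h]
        exact ((isHomogeneous_X_pow 0 p).mul (isHomogeneous_X_pow 1 q)).mul
          (isHomogeneous_X_pow 2 r)
      · simp only [LinearMap.mulLeft_apply]
        ring
    exact ⟨fun h' => (Submodule.add_mem_iff_right G h').mp hmem,
      fun h' => (Submodule.add_mem_iff_left G h').mp hmem⟩
  have hred : ∀ p q r : ℕ, p + q + r = n + 1 →
      ((X 0 ^ p * X 1 ^ q * X 2 ^ r : MvPolynomial (Fin 3) K) ∈ G ↔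
        (X 0 ^ 0 * X 1 ^ (p + q) * X 2 ^ r : MvPolynomial (Fin 3) K) ∈ G) := by
    intro p
    induction p with
    | zero => intro q r _; rw [zero_add]
    | succ p ih =>
      intro q r h
      rw [hswap p q r (by omega), ih (q + 1) r (by omega), show p + (q + 1) = p + 1 + q by omega]
  have hI : ∀ p q r : ℕ, (2 ≤ r ∨ (d ≤ p ∧ c ≤ q) ∨ (c ≤ q ∧ 1 ≤ r)) →
      (X 0 ^ p * X 1 ^ q * X 2 ^ r : MvPolynomial (Fin 3) K) ∈ G := fun p q r h =>
    Submodule.mem_sup_left (X_pow_mul_mem_lefschetzIdeal h)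
  have hall : ∀ p q r : ℕ, p + q + r = n + 1 →
      (X 0 ^ p * X 1 ^ q * X 2 ^ r : MvPolynomial (Fin 3) K) ∈ G := by
    intro p q r h
    obtain rfl | hr := Nat.eq_zero_or_pos r
    · rw [hred p q 0 h, show p + q = d + (n + 1 - d) by omega,
        ← hred d (n + 1 - d) 0 (by omega)]
      exact hI _ _ _ (by omega)
    · rw [hred p q r h]
      exact hI _ _ _ (by omega)
  intro w hw
  rw [w.as_sum]
  refine sum_mem fun m hm => ?_
  have hdeg : m.degree = n + 1 := by
    by_contra hne
    exact mem_support_iff.mp hm (IsHomogeneous.coeff_eq_zero hw hne)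
  rw [monomial_fin_three, ← smul_eq_C_mul]
  exact G.smul_mem _ (hall _ _ _ (by rw [← degree_fin_three, hdeg]))

lemma hasWLP_lefschetzIdeal (hba : b ≤ a) (hcd : c + d + 1 ≤ b) (hd : 1 ≤ d) :
    hasWLP K (lefschetzIdeal K a b c d) := by
  refine ⟨X 0 + X 1, (isHomogeneous_X K 0).add (isHomogeneous_X K 1), fun n => ?_⟩
  by_cases hn : n + 1 < b
  · left
    rintro _ ⟨f, hf, rfl⟩ _ ⟨g, hg, rfl⟩ h
    simp only [AlgHom.toLinearMap_apply, Ideal.Quotient.mkₐ_eq_mk, ← map_mul,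
      Ideal.Quotient.eq, ← mul_sub] at h ⊢
    exact mem_lefschetzIdeal_of_X_add_X_mul_mem hba hn (IsHomogeneous.sub hf hg) h
  · right
    rintro _ ⟨w, hw, rfl⟩
    obtain ⟨g, hg, _, ⟨u, hu, rfl⟩, rfl⟩ := Submodule.mem_sup.mp
      (homogeneousSubmodule_succ_le (a := a) (b := b) (c := c) (d := d)
        (by omega) (by omega) hw)
    refine ⟨_, ⟨u, hu, rfl⟩, ?_⟩
    simp [Ideal.Quotient.eq_zero_iff_mem.mpr (show g ∈ lefschetzIdeal K a b c d from hg)]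

end

theorem stmt_7 (K : Type*) [Field K] [CharZero K] (a b β : ℕ)
    (hba : b ≤ a) (ha : (a : ℤ) ≤ 2 * b - 3)
    (hβ1 : (a : ℤ) - b + 2 ≤ (β : ℤ)) (hβ2 : β ≤ b - 1) :
    hasWLP K (Ideal.span {(X 0 : MvPolynomial (Fin 3) K) ^ a,
      X 1 ^ b - X 0 ^ (b - 1) * X 2, X 2 ^ 2,
      X 0 ^ (a - b + 1) * X 1 ^ (b - β), X 1 ^ (b - β) * X 2}) :=
  hasWLP_lefschetzIdeal hba (by omega) (by omega)
end

section
/- Let K be a field of characteristic zero, R = K[x,y,z], and let a ≥ c ≥ 2 and α, β ∈ {1,2} be integers with c + α ≥ 4. Then the quotient of R by the ideal I_β = (x^a, y^3 − x^α z^{3−α}, z^c, x^{a−α} y^{3−β}, y^{3−β} z^{c+α−3}) has the weak Lefschetz property. -/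
open MvPolynomial

section
variable {B : Type*} [CommRing B]

/-- Modulo a cubic in `p / q` with roots `1`, `8`, `-27`, each form of degree `n + 2` reduces to a
combination of `p ^ 2 * q ^ n`, `p * q ^ (n + 1)`, `q ^ (n + 2)`, with coefficients given by
interpolation at the roots. -/
theorem pow_mul_pow_eq_of_cubic {p q : B}
    (h : p ^ 3 = -18 * p ^ 2 * q + 235 * p * q ^ 2 - 216 * q ^ 3) (n : ℕ) :
    ∀ m k : ℕ, m + k = n + 2 → ∃ r s t : ℤ, r + s + t = 1 ∧ 64 * r + 8 * s + t = 8 ^ m ∧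
      729 * r - 27 * s + t = (-27) ^ m ∧
      p ^ m * q ^ k = r * (p ^ 2 * q ^ n) + s * (p * q ^ (n + 1)) + t * q ^ (n + 2)
  | 0, k, hk => ⟨0, 0, 1, by norm_num, by norm_num, by norm_num, by
      obtain rfl : k = n + 2 := by omega
      push_cast; ring⟩
  | 1, k, hk => ⟨0, 1, 0, by norm_num, by norm_num, by norm_num, by
      obtain rfl : k = n + 1 := by omega
      push_cast; ring⟩
  | 2, k, hk => ⟨1, 0, 0, by norm_num, by norm_num, by norm_num, by
      obtain rfl : k = n := by omega
      push_cast; ring⟩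
  | m + 3, k, hk => by
    obtain ⟨r₂, s₂, t₂, h₂, h₂', h₂'', e₂⟩ :=
      pow_mul_pow_eq_of_cubic h n (m + 2) (k + 1) (by omega)
    obtain ⟨r₁, s₁, t₁, h₁, h₁', h₁'', e₁⟩ :=
      pow_mul_pow_eq_of_cubic h n (m + 1) (k + 2) (by omega)
    obtain ⟨r₀, s₀, t₀, h₀, h₀', h₀'', e₀⟩ :=
      pow_mul_pow_eq_of_cubic h n m (k + 3) (by omega)
    refine ⟨-18 * r₂ + 235 * r₁ - 216 * r₀, -18 * s₂ + 235 * s₁ - 216 * s₀,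
      -18 * t₂ + 235 * t₁ - 216 * t₀, ?_, ?_, ?_, ?_⟩
    · linear_combination -18 * h₂ + 235 * h₁ - 216 * h₀
    · linear_combination -18 * h₂' + 235 * h₁' - 216 * h₀'
    · linear_combination -18 * h₂'' + 235 * h₁'' - 216 * h₀''
    · push_cast
      linear_combination (p ^ m * q ^ k) * h - 18 * e₂ + 235 * e₁ - 216 * e₀

theorem pow_mul_pow_mul_pow_eq_zero
    (hB : ∀ d : ℤ, d ≠ 0 → ∀ b : B, (d : B) * b = 0 → b = 0) {p q y : B}
    (h : p ^ 3 = -18 * p ^ 2 * q + 235 * p * q ^ 2 - 216 * q ^ 3) (hy : 7 * y = p + 6 * q)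
    {n : ℕ} (h₁ : p ^ 2 * q ^ n = 0) (h₂ : p * q ^ (n + 1) = 0) (h₃ : q ^ (n + 2) = 0) :
    ∀ i j k : ℕ, n + 2 ≤ i + j + k → p ^ i * y ^ j * q ^ k = 0 := by
  have of_eq_degree : ∀ i k, i + k = n + 2 → p ^ i * q ^ k = 0 := by
    intro i k hik
    obtain ⟨r, s, t, -, -, -, e⟩ := pow_mul_pow_eq_of_cubic h n i k hik
    rw [e, h₁, h₂, h₃]; ring
  have of_ge_degree : ∀ i k, n + 2 ≤ i + k → p ^ i * q ^ k = 0 := by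
    intro i k hik
    rcases le_total (n + 2) i with hi | hi
    · obtain ⟨e, rfl⟩ := Nat.exists_eq_add_of_le hi
      linear_combination (p ^ e * q ^ k) * of_eq_degree (n + 2) 0 (by omega)
    · obtain ⟨e, rfl⟩ : ∃ e, k = (n + 2 - i) + e := ⟨k - (n + 2 - i), by omega⟩
      rw [pow_add, ← mul_assoc, of_eq_degree i _ (by omega), zero_mul]
  intro i j
  induction j generalizing i with
  | zero => intro k hk; simpa using of_ge_degree i k (by omega)
  | succ j ih =>
    intro k hk
    refine hB 7 (by norm_num) _ ?_
    push_cast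
    linear_combination (p ^ i * y ^ j * q ^ k) * hy + ih (i + 1) k (by omega) +
      6 * ih i (k + 1) (by omega)

theorem pow_mul_pow_mul_pow_eq_zero_of_reversed
    (hB : ∀ d : ℤ, d ≠ 0 → ∀ b : B, (d : B) * b = 0 → b = 0) {p q y : B}
    (h : p ^ 3 = -18 * p ^ 2 * q + 235 * p * q ^ 2 - 216 * q ^ 3) (hy : 7 * y = p + 6 * q)
    {n : ℕ} (h₁ : q ^ 2 * p ^ n = 0) (h₂ : q * p ^ (n + 1) = 0) (h₃ : p ^ (n + 2) = 0) :
    ∀ i j k : ℕ, n + 2 ≤ i + j + k → p ^ i * y ^ j * q ^ k = 0 := by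
  have of_eq_degree : ∀ k i, i + k = n + 2 → p ^ i * q ^ k = 0 := by
    intro k
    induction k using Nat.strong_induction_on with
    | _ k ih =>
      intro i hik
      match k, ih, hik with
      | 0, _, hik => obtain rfl : i = n + 2 := by omega
                     linear_combination h₃
      | 1, _, hik => obtain rfl : i = n + 1 := by omega
                     linear_combination h₂
      | 2, _, hik => obtain rfl : i = n := by omega
                     linear_combination h₁
      | k + 3, ih, hik =>
        refine hB 216 (by norm_num) _ ?_
        push_cast
        linear_combination (p ^ i * q ^ k) * h - ih k (by omega) (i + 3) (by omega) -
          18 * ih (k + 1) (by omega) (i + 2) (by omega) +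
          235 * ih (k + 2) (by omega) (i + 1) (by omega)
  refine pow_mul_pow_mul_pow_eq_zero hB h hy (of_eq_degree n 2 (by omega)) ?_ ?_
  · simpa using of_eq_degree (n + 1) 1 (by omega)
  · simpa using of_eq_degree (n + 2) 0 (by omega)

theorem eight_pow_emod_nine (m : ℕ) : (8 : ℤ) ^ m % 9 = 1 ∨ (8 : ℤ) ^ m % 9 = 8 := by
  induction m with
  | zero => norm_num
  | succ m ih => rw [pow_succ]; omega

theorem pow_mul_sq_eq_zero_of_pow_eq_zero
    (hB : ∀ d : ℤ, d ≠ 0 → ∀ b : B, (d : B) * b = 0 → b = 0) {p q y : B}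
    (h : p ^ 3 = -18 * p ^ 2 * q + 235 * p * q ^ 2 - 216 * q ^ 3) (hy : 7 * y = p + 6 * q)
    {n : ℕ} (hp : p ^ (n + 2) = 0) (hq : q ^ (n + 2) = 0) (hqy : q ^ n * y ^ 2 = 0) :
    p ^ 2 * q ^ n = 0 ∧ p * q ^ (n + 1) = 0 := by
  have hsq : p ^ 2 * q ^ n = -12 * (p * q ^ (n + 1)) := by
    linear_combination 49 * hqy - 36 * hq - (7 * y + p + 6 * q) * q ^ n * hy
  obtain ⟨r, s, t, e₁, e₂, e₃, e⟩ := pow_mul_pow_eq_of_cubic h n (n + 2) 0 (by omega)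
  have hne : s - 12 * r ≠ 0 := by
    intro h0
    have key : 8 * (8 : ℤ) ^ (n + 2) = 3 * (-27) ^ (n + 2) + 5 := by
      linear_combination 140 * h0 - 8 * e₂ + 3 * e₃ + 5 * e₁
    have := eight_pow_emod_nine (n + 2)
    rw [pow_succ (-27 : ℤ)] at key
    omega
  have hpq : p * q ^ (n + 1) = 0 := by
    refine hB _ hne _ ?_
    push_cast
    linear_combination hp - e - (r : B) * hsq - (t : B) * hq
  exact ⟨by rw [hsq, hpq, mul_zero], hpq⟩

theorem interpolation_det_ne_zero (n : ℕ) {r s t r' s' t' : ℤ} (e₁ : r + s + t = 1)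
    (e₂ : 64 * r + 8 * s + t = 8 ^ (n + 2)) (e₃ : 729 * r - 27 * s + t = (-27) ^ (n + 2))
    (e₁' : r' + s' + t' = 1) (e₂' : 64 * r' + 8 * s' + t' = 8 ^ (n + 1))
    (e₃' : 729 * r' - 27 * s' + t' = (-27) ^ (n + 1)) :
    r * (t' - 6 * s') - r' * (t - 6 * s) ≠ 0 := by
  intro h0
  rw [pow_succ] at e₂ e₃
  have hP := eight_pow_emod_nine (n + 1)
  obtain ⟨T, hT⟩ : (27 : ℤ) ∣ (-27) ^ (n + 1) := ⟨-(-27) ^ n, by ring⟩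
  rw [hT] at e₃ e₃'
  generalize (8 : ℤ) ^ (n + 1) = P at e₂ e₂' hP
  have hr : 980 * r = 4 * (8 * P - 1) + (27 * T * (-27) - 1) := by linarith
  have hs : 980 * s = 104 * (8 * P - 1) - 9 * (27 * T * (-27) - 1) := by linarith
  have hr' : 980 * r' = 4 * (P - 1) + (27 * T - 1) := by linarith
  have hs' : 980 * s' = 104 * (P - 1) - 9 * (27 * T - 1) := by linarith
  have key : 27 * (T * (5 * P - 8)) + 3 * P = 0 := by
    have h1 : (980 * r) * (980 - (980 * r') - 7 * (980 * s')) -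
        (980 * r') * (980 - (980 * r) - 7 * (980 * s)) = 0 := by
      linear_combination 980 ^ 2 * (h0 + r' * e₁ - r * e₁')
    rw [hr, hs, hr', hs'] at h1
    ring_nf at h1 ⊢
    linarith
  generalize T * (5 * P - 8) = v at key
  clear hT e₁ e₂ e₃ e₁' e₂' e₃' hr hs hr' hs' h0
  omega

theorem mul_pow_eq_zero_of_pow_mul_eq_zero
    (hB : ∀ d : ℤ, d ≠ 0 → ∀ b : B, (d : B) * b = 0 → b = 0) {p q y : B}
    (h : p ^ 3 = -18 * p ^ 2 * q + 235 * p * q ^ 2 - 216 * q ^ 3) (hy : 7 * y = p + 6 * q)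
    {n : ℕ} (hp : p ^ (n + 2) = 0) (hpy : p ^ (n + 1) * y = 0) (hqy : q ^ (n + 1) * y = 0) :
    p ^ 2 * q ^ n = 0 ∧ p * q ^ (n + 1) = 0 ∧ q ^ (n + 2) = 0 := by
  have hpq : p ^ (n + 1) * q = 0 := by
    refine hB 6 (by norm_num) _ ?_
    push_cast
    linear_combination 7 * hpy - hp - p ^ (n + 1) * hy
  have hqp : p * q ^ (n + 1) = -6 * q ^ (n + 2) := by
    linear_combination 7 * hqy - q ^ (n + 1) * hy
  obtain ⟨r, s, t, e₁, e₂, e₃, e⟩ := pow_mul_pow_eq_of_cubic h n (n + 2) 0 (by omega)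
  obtain ⟨r', s', t', e₁', e₂', e₃', e'⟩ := pow_mul_pow_eq_of_cubic h n (n + 1) 1 (by omega)
  have hne : r * (t' - 6 * s') - r' * (t - 6 * s) ≠ 0 := by
    intro h0
    exact interpolation_det_ne_zero n e₁ e₂ e₃ e₁' e₂' e₃' h0
  have hE : (r : B) * (p ^ 2 * q ^ n) + ((t : B) - 6 * s) * q ^ (n + 2) = 0 := by
    linear_combination hp - e - (s : B) * hqp
  have hE' : (r' : B) * (p ^ 2 * q ^ n) + ((t' : B) - 6 * s') * q ^ (n + 2) = 0 := by
    linear_combination hpq - e' - (s' : B) * hqp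
  have hq : q ^ (n + 2) = 0 := by
    refine hB _ hne _ ?_
    push_cast
    linear_combination (r : B) * hE' - (r' : B) * hE
  refine ⟨hB _ hne _ ?_, by rw [hqp, hq, mul_zero], hq⟩
  push_cast
  linear_combination ((t' : B) - 6 * s') * hE - ((t : B) - 6 * s) * hE'

end

section
variable {K : Type*} [Field K]

/-- If `φ` induces a nondegenerate pairing on `R/I` with socle degree `D` and `R/(I, L)` vanishes in
degrees at least `N ≤ (D + 2) / 2`, then `L` is a weak Lefschetz element. -/
theorem hasWLP_of_duality {I : Ideal (MvPolynomial (Fin 3) K)} {s : Set (MvPolynomial (Fin 3) K)}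
    (hs : I = Ideal.span s) (hs' : ∀ f ∈ s, ∃ n, f.IsHomogeneous n)
    {L : MvPolynomial (Fin 3) K} (hL : L.IsHomogeneous 1) {D N : ℕ} (hN : 2 * N ≤ D + 2)
    (φ : MvPolynomial (Fin 3) K →ₗ[K] K) (hφ : ∀ f ∈ I, φ f = 0)
    (hdual : ∀ i ≤ D, ∀ u : MvPolynomial (Fin 3) K, u.IsHomogeneous i →
      (∀ v : MvPolynomial (Fin 3) K, v.IsHomogeneous (D - i) → φ (u * v) = 0) → u ∈ I)
    (hsurj : ∀ f : MvPolynomial (Fin 3) K, ∀ j, N ≤ j → f.IsHomogeneous j →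
      f ∈ I ⊔ Ideal.span {L}) : hasWLP K I := by
  have hcomp : ∀ f ∈ I, ∀ n, homogeneousComponent n f ∈ I := by
    subst hs
    intro f hf n
    let _ := MvPolynomial.gradedAlgebra (σ := Fin 3) (R := K)
    exact homogeneousComponent_mem_of_mem (Ideal.homogeneous_span _ _ hs') hf n
  have hlift : ∀ f : MvPolynomial (Fin 3) K, ∀ j, N ≤ j + 1 → f.IsHomogeneous (j + 1) →
      ∃ g : MvPolynomial (Fin 3) K, g.IsHomogeneous j ∧ f - L * g ∈ I := by
    intro f j hj hf
    obtain ⟨h, hh, l, hl, rfl⟩ := Submodule.mem_sup.mp (hsurj f _ hj hf)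
    obtain ⟨g, rfl⟩ := Ideal.mem_span_singleton.mp hl
    refine ⟨homogeneousComponent j g, homogeneousComponent_isHomogeneous _ _, ?_⟩
    have hLg : homogeneousComponent (j + 1) (L * g) = L * homogeneousComponent j g := by
      conv_lhs => rw [← sum_homogeneousComponent g, Finset.mul_sum, map_sum]
      have hterm : ∀ i, homogeneousComponent (j + 1) (L * homogeneousComponent i g) =
          if i = j then L * homogeneousComponent j g else 0 := by
        intro i
        rw [homogeneousComponent_of_mem (n := 1 + i)
          (hL.mul (homogeneousComponent_isHomogeneous _ _))]
        by_cases hij : i = j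
        · subst hij; simp [add_comm]
        · rw [if_neg (by omega), if_neg hij]
      simp_rw [hterm]
      rw [Finset.sum_ite_eq']
      split_ifs with hmem
      · rfl
      · have hlt : g.totalDegree < j := by
          rw [Finset.mem_range] at hmem
          omega
        rw [homogeneousComponent_eq_zero _ _ hlt, mul_zero]
    have hsplit : h + L * g = homogeneousComponent (j + 1) h + L * homogeneousComponent j g := by
      rw [← hLg, ← map_add, homogeneousComponent_eq_self hf]
    rw [hsplit, add_sub_cancel_right]
    exact hcomp h hh (j + 1)
  refine ⟨L, hL, fun i => ?_⟩
  by_cases hi : N ≤ i + 1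
  · right
    rintro _ ⟨f, hf, rfl⟩
    obtain ⟨g, hg, hfg⟩ := hlift f i hi hf
    exact ⟨_, ⟨g, hg, rfl⟩, (Ideal.Quotient.eq.mpr hfg).symm⟩
  · left
    rintro _ ⟨u, hu, rfl⟩ _ ⟨v, hv, rfl⟩ huv
    have huv' : L * u - L * v ∈ I := Ideal.Quotient.eq.mp huv
    refine Ideal.Quotient.eq.mpr (hdual i (by omega) _ (IsHomogeneous.sub hu hv) fun w hw => ?_)
    obtain ⟨e, he⟩ : ∃ e, D - i = e + 1 := ⟨D - i - 1, by omega⟩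
    obtain ⟨g, -, hg⟩ := hlift w e (by omega) (he ▸ hw)
    refine hφ _ ?_
    have : (u - v) * w = (u - v) * (w - L * g) + g * (L * u - L * v) := by ring
    rw [this]
    exact I.add_mem (I.mul_mem_left _ hg) (I.mul_mem_left _ huv')

/-- The functional summing the coefficients of the monomials of bidegree `(A, C)`, where
`x`, `y`, `z` have bidegrees `(3, 0)`, `(α, 3 - α)`, `(0, 3)`. -/
noncomputable def bidegreeFunctional (K : Type*) [Field K] (α A C : ℕ) :
    MvPolynomial (Fin 3) K →ₗ[K] K :=
  (basisMonomials (Fin 3) K).constr K fun d =>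
    if 3 * d 0 + α * d 1 = A ∧ 3 * d 2 + (3 - α) * d 1 = C then 1 else 0

theorem bidegreeFunctional_monomial (α A C : ℕ) (d : Fin 3 →₀ ℕ) :
    bidegreeFunctional K α A C (monomial d 1) =
      if 3 * d 0 + α * d 1 = A ∧ 3 * d 2 + (3 - α) * d 1 = C then 1 else 0 := by
  have h := Module.Basis.constr_basis (basisMonomials (Fin 3) K) K (fun d =>
    if 3 * d 0 + α * d 1 = A ∧ 3 * d 2 + (3 - α) * d 1 = C then (1 : K) else 0) d
  rwa [coe_basisMonomials] at h

theorem monomial_fin_three_s11 (d : Fin 3 →₀ ℕ) :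
    (monomial d 1 : MvPolynomial (Fin 3) K) = X 0 ^ d 0 * X 1 ^ d 1 * X 2 ^ d 2 := by
  rw [monomial_eq, Finsupp.prod_fintype _ _ (by simp)]
  simp [Fin.prod_univ_three]

theorem exists_finsupp_fin_three (i j k : ℕ) :
    ∃ d : Fin 3 →₀ ℕ, d 0 = i ∧ d 1 = j ∧ d 2 = k :=
  ⟨Finsupp.equivFunOnFinite.symm ![i, j, k], by simp⟩

theorem bidegreeFunctional_X_pow (α A C i j k : ℕ) :
    bidegreeFunctional K α A C (X 0 ^ i * X 1 ^ j * X 2 ^ k) =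
      if 3 * i + α * j = A ∧ 3 * k + (3 - α) * j = C then 1 else 0 := by
  obtain ⟨d, rfl, rfl, rfl⟩ := exists_finsupp_fin_three i j k
  rw [← monomial_fin_three_s11, bidegreeFunctional_monomial]

theorem eq_sum_smul_monomial (f : MvPolynomial (Fin 3) K) :
    f = ∑ d ∈ f.support, f.coeff d • monomial d (1 : K) := by
  conv_lhs => rw [f.as_sum]
  simp [smul_monomial]

theorem degree_fin_three_s11 (d : Fin 3 →₀ ℕ) : d.degree = d 0 + d 1 + d 2 := by
  rw [Finsupp.degree_eq_sum, Fin.sum_univ_three]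

theorem linearMap_eq_zero_on_span {s : Set (MvPolynomial (Fin 3) K)}
    (φ : MvPolynomial (Fin 3) K →ₗ[K] K)
    (h : ∀ f ∈ s, ∀ i j k : ℕ, φ (X 0 ^ i * X 1 ^ j * X 2 ^ k * f) = 0) :
    ∀ f ∈ Ideal.span s, φ f = 0 := by
  suffices ∀ f ∈ Ideal.span s, ∀ g, φ (g * f) = 0 from fun f hf => by simpa using this f hf 1
  intro f hf
  induction hf using Submodule.span_induction with
  | mem f hf =>
    intro g
    rw [eq_sum_smul_monomial g, Finset.sum_mul, map_sum]
    refine Finset.sum_eq_zero fun d _ => ?_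
    rw [smul_mul_assoc, map_smul, monomial_fin_three_s11, h f hf, smul_zero]
  | zero => simp
  | add f g _ _ hf hg => intro p; rw [mul_add, map_add, hf, hg, add_zero]
  | smul r f _ hf => intro p; rw [smul_eq_mul, ← mul_assoc, hf]

/-- If monomials of equal bidegree agree modulo `I` and every monomial outside `I` has a complement
of total bidegree `(A, C)`, then the pairing induced by `bidegreeFunctional` is nondegenerate. -/
theorem mem_of_bidegreeFunctional_mul_eq_zero {I : Ideal (MvPolynomial (Fin 3) K)} {α A C D : ℕ}
    (hα : α ≤ 3) (hD : A + C = 3 * D)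
    (hcongr : ∀ i j k i' j' k' : ℕ, 3 * i + α * j = 3 * i' + α * j' →
      3 * k + (3 - α) * j = 3 * k' + (3 - α) * j' →
      (X 0 ^ i * X 1 ^ j * X 2 ^ k - X 0 ^ i' * X 1 ^ j' * X 2 ^ k' : MvPolynomial (Fin 3) K) ∈ I)
    (hcompl : ∀ i j k : ℕ, (X 0 ^ i * X 1 ^ j * X 2 ^ k : MvPolynomial (Fin 3) K) ∈ I ∨
      ∃ i' j' k' : ℕ, 3 * (i + i') + α * (j + j') = A ∧ 3 * (k + k') + (3 - α) * (j + j') = C)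
    {n : ℕ} {u : MvPolynomial (Fin 3) K} (hu : u.IsHomogeneous n)
    (h : ∀ v : MvPolynomial (Fin 3) K, v.IsHomogeneous (D - n) →
      bidegreeFunctional K α A C (u * v) = 0) : u ∈ I := by
  classical
  let w : (Fin 3 →₀ ℕ) → ℕ × ℕ := fun d => (3 * d 0 + α * d 1, 3 * d 2 + (3 - α) * d 1)
  rw [eq_sum_smul_monomial u, ← Finset.sum_fiberwise_of_maps_to
    (fun d hd => Finset.mem_image_of_mem w hd)]
  refine I.sum_mem fun b hb => ?_
  obtain ⟨d₀, hd₀, rfl⟩ := Finset.mem_image.mp hb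
  have hreduce : (∑ d ∈ u.support with w d = w d₀, u.coeff d • monomial d (1 : K)) -
      (∑ d ∈ u.support with w d = w d₀, u.coeff d) • monomial d₀ (1 : K) ∈ I := by
    rw [Finset.sum_smul, ← Finset.sum_sub_distrib]
    refine I.sum_mem fun d hd => ?_
    have hw := Prod.ext_iff.mp (Finset.mem_filter.mp hd).2
    rw [← smul_sub, smul_eq_C_mul, monomial_fin_three_s11, monomial_fin_three_s11]
    exact I.mul_mem_left _ (hcongr _ _ _ _ _ _ hw.1 hw.2)
  refine (I.sub_mem_iff_left ?_).mp hreduce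
  rcases hcompl (d₀ 0) (d₀ 1) (d₀ 2) with hmem | ⟨i', j', k', h₁, h₂⟩
  · rw [smul_eq_C_mul, monomial_fin_three_s11]
    exact I.mul_mem_left _ hmem
  · obtain ⟨e, rfl, rfl, rfl⟩ := exists_finsupp_fin_three i' j' k'
    have hdeg : e.degree = D - n := by
      have hn : d₀.degree = n := by
        by_contra hne
        exact (mem_support_iff.mp hd₀) (hu.coeff_eq_zero hne)
      rw [degree_fin_three_s11] at hn ⊢
      have hsum : α * (d₀ 1 + e 1) + (3 - α) * (d₀ 1 + e 1) = 3 * (d₀ 1 + e 1) := by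
        rw [← add_mul, Nat.add_sub_cancel' hα]
      omega
    have hzero := h (monomial e 1) (isHomogeneous_monomial _ hdeg)
    conv at hzero => lhs; rw [eq_sum_smul_monomial u, Finset.sum_mul, map_sum]
    have hsum : (∑ d ∈ u.support with w d = w d₀, u.coeff d) = 0 := by
      rw [← hzero, Finset.sum_filter]
      refine Finset.sum_congr rfl fun d _ => ?_
      rw [smul_mul_assoc, map_smul, monomial_mul, one_mul, bidegreeFunctional_monomial,
        smul_eq_mul, mul_ite, mul_one, mul_zero]
      refine if_congr ?_ rfl rfl
      simp only [w, Prod.mk.injEq, Finsupp.add_apply, ← h₁, ← h₂]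
      constructor <;> rintro ⟨h₃, h₄⟩ <;> constructor <;> nlinarith
    rw [hsum, zero_smul]
    exact I.zero_mem

end

section
variable {B : Type*} [CommRing B]

theorem cubic_relation {p q y : B} (hy : 7 * y = p + 6 * q) (hy3 : y ^ 3 = p * q ^ 2) :
    p ^ 3 = -18 * p ^ 2 * q + 235 * p * q ^ 2 - 216 * q ^ 3 := by
  linear_combination 343 * hy3 - (49 * y ^ 2 + 7 * y * (p + 6 * q) + (p + 6 * q) ^ 2) * hy

theorem exists_monomials_eq_zero_of_alpha_eq_one
    (hB : ∀ d : ℤ, d ≠ 0 → ∀ b : B, (d : B) * b = 0 → b = 0) {x y z : B} {a c β : ℕ}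
    (hc : 3 ≤ c) (hac : c ≤ a) (hβ : β = 1 ∨ β = 2) (hy : 7 * y = x + 6 * z)
    (hy3 : y ^ 3 = x * z ^ 2) (hx : x ^ a = 0) (hz : z ^ c = 0)
    (hyz : y ^ (3 - β) * z ^ (c - 2) = 0) :
    ∃ N, 2 * N ≤ a + c - β + 2 ∧ ∀ i j k : ℕ, N ≤ i + j + k → x ^ i * y ^ j * z ^ k = 0 := by
  have h := cubic_relation hy hy3
  obtain ⟨n, rfl⟩ : ∃ n, c = n + 2 := ⟨c - 2, by omega⟩
  rw [Nat.add_sub_cancel] at hyz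
  rcases hβ with rfl | rfl
  · norm_num at hyz
    rcases hac.eq_or_lt with rfl | hlt
    · obtain ⟨h₁, h₂⟩ := pow_mul_sq_eq_zero_of_pow_eq_zero hB h hy hx hz (by rw [mul_comm, hyz])
      exact ⟨n + 2, by omega, pow_mul_pow_mul_pow_eq_zero hB h hy h₁ h₂ hz⟩
    · refine ⟨n + 1 + 2, by omega, pow_mul_pow_mul_pow_eq_zero hB h hy ?_ ?_ ?_⟩
      · linear_combination 49 * z * hyz - (7 * y + x + 6 * z) * z ^ (n + 1) * hy -
          (12 * x + 36 * z) * hz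
      · linear_combination x * hz
      · linear_combination z * hz
  · norm_num at hyz
    have h₂ : x * z ^ (n + 1) = 0 := by
      linear_combination 7 * z * hyz - z ^ (n + 1) * hy - 6 * hz
    refine ⟨n + 2, by omega, pow_mul_pow_mul_pow_eq_zero hB h hy ?_ h₂ hz⟩
    linear_combination 7 * x * hyz - x * z ^ n * hy - 6 * h₂

theorem exists_monomials_eq_zero_of_alpha_eq_two
    (hB : ∀ d : ℤ, d ≠ 0 → ∀ b : B, (d : B) * b = 0 → b = 0) {p y q : B} {a c β : ℕ}
    (hc : 2 ≤ c) (hac : c ≤ a) (hβ : β = 1 ∨ β = 2) (hy : 7 * y = p + 6 * q)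
    (hy3 : y ^ 3 = p * q ^ 2) (hq : q ^ a = 0) (hp : p ^ c = 0)
    (hqy : q ^ (a - 2) * y ^ (3 - β) = 0) (hpy : y ^ (3 - β) * p ^ (c - 1) = 0) :
    ∃ N, 2 * N ≤ a + c - β + 2 ∧ ∀ i j k : ℕ, N ≤ i + j + k → p ^ i * y ^ j * q ^ k = 0 := by
  have h := cubic_relation hy hy3
  obtain ⟨n, rfl⟩ : ∃ n, c = n + 2 := ⟨c - 2, by omega⟩
  rw [show n + 2 - 1 = n + 1 by omega] at hpy
  rcases hβ with rfl | rfl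
  · norm_num at hpy hqy
    rcases hac.eq_or_lt with rfl | hlt
    · rw [Nat.add_sub_cancel] at hqy
      obtain ⟨h₁, h₂⟩ := pow_mul_sq_eq_zero_of_pow_eq_zero hB h hy hp hq hqy
      exact ⟨n + 2, by omega, pow_mul_pow_mul_pow_eq_zero hB h hy h₁ h₂ hq⟩
    · refine ⟨n + 1 + 2, by omega, pow_mul_pow_mul_pow_eq_zero_of_reversed hB h hy ?_ ?_ ?_⟩
      · refine hB 36 (by norm_num) _ ?_
        push_cast
        linear_combination 49 * hpy - (7 * y + p + 6 * q) * p ^ (n + 1) * hy -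
          (p + 12 * q) * hp
      · linear_combination q * hp
      · linear_combination p * hp
  · norm_num at hpy hqy
    obtain rfl | rfl | hlt : a = n + 2 ∨ a = n + 3 ∨ n + 4 ≤ a := by omega
    · rw [Nat.add_sub_cancel] at hqy
      have h₂ : p * q ^ (n + 1) = 0 := by
        linear_combination 7 * q * hqy - q ^ (n + 1) * hy - 6 * hq
      refine ⟨n + 2, by omega, pow_mul_pow_mul_pow_eq_zero hB h hy ?_ h₂ hq⟩
      linear_combination 7 * p * hqy - p * q ^ n * hy - 6 * h₂
    · rw [show n + 3 - 2 = n + 1 by omega] at hqy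
      obtain ⟨h₁, h₂, h₃⟩ := mul_pow_eq_zero_of_pow_mul_eq_zero hB h hy hp
        (by rw [mul_comm, hpy]) hqy
      exact ⟨n + 2, by omega, pow_mul_pow_mul_pow_eq_zero hB h hy h₁ h₂ h₃⟩
    · refine ⟨n + 1 + 2, by omega, pow_mul_pow_mul_pow_eq_zero_of_reversed hB h hy ?_ ?_ ?_⟩
      · refine hB 6 (by norm_num) _ ?_
        push_cast
        linear_combination 7 * q * hpy - q * p ^ (n + 1) * hy - q * hp
      · linear_combination q * hp
      · linear_combination p * hp

theorem pow_mul_pow_eq_of_bidegree_eq {x y z : B} {α : ℕ} (hα : α = 1 ∨ α = 2)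
    (hy3 : y ^ 3 = x ^ α * z ^ (3 - α)) {i j k i' j' k' : ℕ}
    (h₁ : 3 * i + α * j = 3 * i' + α * j') (h₂ : 3 * k + (3 - α) * j = 3 * k' + (3 - α) * j') :
    x ^ i * y ^ j * z ^ k = x ^ i' * y ^ j' * z ^ k' := by
  wlog hj : j' ≤ j generalizing i j k i' j' k'
  · exact (this h₁.symm h₂.symm (by omega)).symm
  obtain ⟨q, rfl, rfl, rfl⟩ : ∃ q, j = j' + 3 * q ∧ i' = i + α * q ∧ k' = k + (3 - α) * q := by
    refine ⟨(j - j') / 3, ?_⟩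
    rcases hα with rfl | rfl <;> omega
  rw [pow_add y, pow_mul y, hy3, mul_pow, ← pow_mul, ← pow_mul, pow_add x, pow_add z]
  ring

end

section
variable {K : Type*} [Field K]

theorem quotient_intCast_mul_eq_zero [CharZero K] (Q : Ideal (MvPolynomial (Fin 3) K)) (d : ℤ)
    (hd : d ≠ 0) (b : MvPolynomial (Fin 3) K ⧸ Q) (h : (d : MvPolynomial (Fin 3) K ⧸ Q) * b = 0) :
    b = 0 := by
  have hu : IsUnit (d : MvPolynomial (Fin 3) K ⧸ Q) := by
    rw [← map_intCast (algebraMap K (MvPolynomial (Fin 3) K ⧸ Q))]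
    exact (IsUnit.mk0 _ (Int.cast_ne_zero.mpr hd)).map _
  exact (hu.mul_right_eq_zero).mp h

theorem mem_of_monomials_mem {Q : Ideal (MvPolynomial (Fin 3) K)} {N : ℕ}
    (h : ∀ i j k : ℕ, N ≤ i + j + k → (X 0 ^ i * X 1 ^ j * X 2 ^ k : MvPolynomial (Fin 3) K) ∈ Q)
    (f : MvPolynomial (Fin 3) K) (j : ℕ) (hj : N ≤ j) (hf : f.IsHomogeneous j) : f ∈ Q := by
  rw [eq_sum_smul_monomial f]
  refine Q.sum_mem fun d hd => ?_
  have hdeg : d.degree = j := by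
    by_contra hne
    exact (mem_support_iff.mp hd) (hf.coeff_eq_zero hne)
  rw [degree_fin_three_s11] at hdeg
  rw [smul_eq_C_mul, monomial_fin_three_s11]
  exact Q.mul_mem_left _ (h _ _ _ (by omega))

theorem exists_complement {a c α β : ℕ} (hc : 2 ≤ c) (hac : c ≤ a) (hα : α = 1 ∨ α = 2)
    (hβ : β = 1 ∨ β = 2) (hcα : 4 ≤ c + α) {i j k : ℕ} (hj : j < 3) (hi : i < a) (hk : k < c)
    (hij : 3 - β ≤ j → i < a - α) (hjk : 3 - β ≤ j → k < c + α - 3) :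
    ∃ i' j' k' : ℕ, 3 * (i + i') + α * (j + j') = 3 * (a - 1) + α * (2 - β) ∧
      3 * (k + k') + (3 - α) * (j + j') = 3 * (c - 1) + (3 - α) * (2 - β) := by
  by_cases h : j ≤ 2 - β
  · exact ⟨a - 1 - i, 2 - β - j, c - 1 - k, by
      rw [Nat.add_sub_cancel' h]; omega, by rw [Nat.add_sub_cancel' h]; omega⟩
  · have h₁ := hij (by omega)
    have h₂ := hjk (by omega)
    refine ⟨a - 1 - α - i, 5 - β - j, c + α - 4 - k, ?_⟩
    rw [show j + (5 - β - j) = 5 - β by omega]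
    rcases hα with rfl | rfl <;> rcases hβ with rfl | rfl <;> omega

end

theorem stmt_11 (K : Type*) [Field K] [CharZero K] (a c α β : ℕ)
    (hc : 2 ≤ c) (hac : c ≤ a) (hα : α = 1 ∨ α = 2) (hβ : β = 1 ∨ β = 2)
    (hcα : 4 ≤ c + α) :
    hasWLP K (Ideal.span {(X 0 : MvPolynomial (Fin 3) K) ^ a,
      X 1 ^ 3 - X 0 ^ α * X 2 ^ (3 - α), X 2 ^ c,
      X 0 ^ (a - α) * X 1 ^ (3 - β), X 1 ^ (3 - β) * X 2 ^ (c + α - 3)}) := by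
  set s : Set (MvPolynomial (Fin 3) K) := {(X 0 : MvPolynomial (Fin 3) K) ^ a,
    X 1 ^ 3 - X 0 ^ α * X 2 ^ (3 - α), X 2 ^ c,
    X 0 ^ (a - α) * X 1 ^ (3 - β), X 1 ^ (3 - β) * X 2 ^ (c + α - 3)} with hs
  have hx : (X 0 : MvPolynomial (Fin 3) K) ^ a ∈ s := by simp [hs]
  have hy : (X 1 ^ 3 - X 0 ^ α * X 2 ^ (3 - α) : MvPolynomial (Fin 3) K) ∈ s := by simp [hs]
  have hz : (X 2 : MvPolynomial (Fin 3) K) ^ c ∈ s := by simp [hs]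
  have hxy : (X 0 ^ (a - α) * X 1 ^ (3 - β) : MvPolynomial (Fin 3) K) ∈ s := by simp [hs]
  have hyz : (X 1 ^ (3 - β) * X 2 ^ (c + α - 3) : MvPolynomial (Fin 3) K) ∈ s := by simp [hs]
  have hhom : ∀ f ∈ s, ∃ n, f.IsHomogeneous n := by
    rintro f (rfl | rfl | rfl | rfl | rfl)
    · exact ⟨_, isHomogeneous_X_pow _ _⟩
    · refine ⟨3, (isHomogeneous_X_pow _ _).sub ?_⟩
      have := (isHomogeneous_X_pow (R := K) (0 : Fin 3) α).mul
        (isHomogeneous_X_pow (R := K) (2 : Fin 3) (3 - α))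
      rwa [show α + (3 - α) = 3 by omega] at this
    · exact ⟨_, isHomogeneous_X_pow _ _⟩
    · exact ⟨_, (isHomogeneous_X_pow _ _).mul (isHomogeneous_X_pow _ _)⟩
    · exact ⟨_, (isHomogeneous_X_pow _ _).mul (isHomogeneous_X_pow _ _)⟩
  have hvanish : ∀ f ∈ Ideal.span s, bidegreeFunctional K α (3 * (a - 1) + α * (2 - β))
      (3 * (c - 1) + (3 - α) * (2 - β)) f = 0 := by
    refine linearMap_eq_zero_on_span _ ?_
    rintro f (rfl | rfl | rfl | rfl | rfl) i j k
    · rw [show (X 0 ^ i * X 1 ^ j * X 2 ^ k * X 0 ^ a : MvPolynomial (Fin 3) K) =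
        X 0 ^ (i + a) * X 1 ^ j * X 2 ^ k by ring, bidegreeFunctional_X_pow, if_neg]
      rcases hα with rfl | rfl <;> rcases hβ with rfl | rfl <;> omega
    · rw [show (X 0 ^ i * X 1 ^ j * X 2 ^ k * (X 1 ^ 3 - X 0 ^ α * X 2 ^ (3 - α)) :
          MvPolynomial (Fin 3) K) = X 0 ^ i * X 1 ^ (j + 3) * X 2 ^ k -
          X 0 ^ (i + α) * X 1 ^ j * X 2 ^ (k + (3 - α)) by ring, map_sub,
        bidegreeFunctional_X_pow, bidegreeFunctional_X_pow, sub_eq_zero]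
      refine if_congr ?_ rfl rfl
      rw [mul_add α, mul_add (3 - α)]
      omega
    · rw [show (X 0 ^ i * X 1 ^ j * X 2 ^ k * X 2 ^ c : MvPolynomial (Fin 3) K) =
        X 0 ^ i * X 1 ^ j * X 2 ^ (k + c) by ring, bidegreeFunctional_X_pow, if_neg]
      rcases hα with rfl | rfl <;> rcases hβ with rfl | rfl <;> omega
    · rw [show (X 0 ^ i * X 1 ^ j * X 2 ^ k * (X 0 ^ (a - α) * X 1 ^ (3 - β)) :
          MvPolynomial (Fin 3) K) = X 0 ^ (i + (a - α)) * X 1 ^ (j + (3 - β)) * X 2 ^ k by ring,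
        bidegreeFunctional_X_pow, if_neg]
      rcases hα with rfl | rfl <;> rcases hβ with rfl | rfl <;> omega
    · rw [show (X 0 ^ i * X 1 ^ j * X 2 ^ k * (X 1 ^ (3 - β) * X 2 ^ (c + α - 3)) :
          MvPolynomial (Fin 3) K) = X 0 ^ i * X 1 ^ (j + (3 - β)) * X 2 ^ (k + (c + α - 3)) by ring,
        bidegreeFunctional_X_pow, if_neg]
      rcases hα with rfl | rfl <;> rcases hβ with rfl | rfl <;> omega
  clear_value s
  clear hs
  have hcongr : ∀ i j k i' j' k' : ℕ, 3 * i + α * j = 3 * i' + α * j' →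
      3 * k + (3 - α) * j = 3 * k' + (3 - α) * j' →
      (X 0 ^ i * X 1 ^ j * X 2 ^ k - X 0 ^ i' * X 1 ^ j' * X 2 ^ k' : MvPolynomial (Fin 3) K) ∈
        Ideal.span s := by
    intro i j k i' j' k' h₁ h₂
    have hy3 := Ideal.Quotient.eq.mpr (Ideal.subset_span hy)
    rw [map_mul, map_pow, map_pow, map_pow] at hy3
    rw [← Ideal.Quotient.eq]
    simpa only [map_mul, map_pow] using pow_mul_pow_eq_of_bidegree_eq hα hy3 h₁ h₂
  have hcompl : ∀ i j k : ℕ, (X 0 ^ i * X 1 ^ j * X 2 ^ k : MvPolynomial (Fin 3) K) ∈ Ideal.span s ∨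
      ∃ i' j' k' : ℕ, 3 * (i + i') + α * (j + j') = 3 * (a - 1) + α * (2 - β) ∧
        3 * (k + k') + (3 - α) * (j + j') = 3 * (c - 1) + (3 - α) * (2 - β) := by
    intro i j k
    obtain ⟨q, r, hr, rfl⟩ : ∃ q r, r < 3 ∧ j = r + 3 * q :=
      ⟨j / 3, j % 3, Nat.mod_lt _ (by norm_num), (Nat.mod_add_div j 3).symm⟩
    have hreduce := hcongr i (r + 3 * q) k (i + α * q) r (k + (3 - α) * q) (by ring) (by ring)
    have hmem : (X 0 ^ (i + α * q) * X 1 ^ r * X 2 ^ (k + (3 - α) * q) : MvPolynomial (Fin 3) K) ∈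
        Ideal.span s → (X 0 ^ i * X 1 ^ (r + 3 * q) * X 2 ^ k : MvPolynomial (Fin 3) K) ∈
        Ideal.span s := fun h => ((Ideal.span s).sub_mem_iff_left h).mp hreduce
    have hdvd : ∀ f ∈ s, f ∣ X 0 ^ (i + α * q) * X 1 ^ r * X 2 ^ (k + (3 - α) * q) →
        (X 0 ^ i * X 1 ^ (r + 3 * q) * X 2 ^ k : MvPolynomial (Fin 3) K) ∈ Ideal.span s :=
      fun f hf hfd => hmem (Ideal.mem_of_dvd _ hfd (Ideal.subset_span hf))
    refine or_iff_not_imp_left.mpr fun hnot => ?_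
    obtain ⟨i', j', k', h₁, h₂⟩ := exists_complement hc hac hα hβ hcα (i := i + α * q) (j := r)
      (k := k + (3 - α) * q) hr
      (not_le.mp fun h => hnot (hdvd _ hx (((pow_dvd_pow _ h).mul_right _).mul_right _)))
      (not_le.mp fun h => hnot (hdvd _ hz ((pow_dvd_pow _ h).mul_left _)))
      (fun hr => not_le.mp fun h => hnot (hdvd _ hxy
        ((mul_dvd_mul (pow_dvd_pow _ h) (pow_dvd_pow _ hr)).mul_right _)))
      (fun hr => not_le.mp fun h => hnot (hdvd _ hyz (by
        rw [mul_assoc]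
        exact (mul_dvd_mul (pow_dvd_pow _ hr) (pow_dvd_pow _ h)).mul_left _)))
    exact ⟨i', j', k', by rw [← h₁]; ring, by rw [← h₂]; ring⟩
  have hsurj : ∃ L : MvPolynomial (Fin 3) K, L.IsHomogeneous 1 ∧
      ∃ N, 2 * N ≤ a + c - β + 2 ∧ ∀ i j k : ℕ, N ≤ i + j + k →
        (X 0 ^ i * X 1 ^ j * X 2 ^ k : MvPolynomial (Fin 3) K) ∈ Ideal.span s ⊔ Ideal.span {L} := by
    have hlinear : ∀ i j : Fin 3, (X i + 6 * X j - 7 * X 1 : MvPolynomial (Fin 3) K).IsHomogeneous 1 :=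
      fun i j => ((isHomogeneous_X K i).add (isHomogeneous_C_mul_X 6 j)).sub
        (isHomogeneous_C_mul_X 7 1)
    have hzero : ∀ L : MvPolynomial (Fin 3) K, ∀ f ∈ s,
        Ideal.Quotient.mk (Ideal.span s ⊔ Ideal.span {L}) f = 0 := fun L f hf =>
      Ideal.Quotient.eq_zero_iff_mem.mpr (Ideal.mem_sup_left (Ideal.subset_span hf))
    have hzero' : ∀ L : MvPolynomial (Fin 3) K,
        Ideal.Quotient.mk (Ideal.span s ⊔ Ideal.span {L}) L = 0 := fun L =>
      Ideal.Quotient.eq_zero_iff_mem.mpr (Ideal.mem_sup_right (Ideal.mem_span_singleton_self L))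
    rcases hα with rfl | rfl
    · refine ⟨X 0 + 6 * X 2 - 7 * X 1, hlinear 0 2, ?_⟩
      have hL := hzero' (X 0 + 6 * X 2 - 7 * X 1)
      have hf := hzero (X 0 + 6 * X 2 - 7 * X 1)
      have hx := hf _ hx
      have hy := hf _ hy
      have hz := hf _ hz
      have hyz := hf _ hyz
      simp only [map_sub, map_add, map_mul, map_pow, map_ofNat, sub_eq_zero, pow_one] at hL hx hy hz hyz
      obtain ⟨N, hN, h⟩ := exists_monomials_eq_zero_of_alpha_eq_one
        (quotient_intCast_mul_eq_zero _) (by omega) hac hβ hL.symm hy hx hz hyz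
      refine ⟨N, hN, fun i j k hijk => ?_⟩
      rw [← Ideal.Quotient.eq_zero_iff_mem]
      simpa only [map_mul, map_pow] using h i j k hijk
    · refine ⟨X 2 + 6 * X 0 - 7 * X 1, hlinear 2 0, ?_⟩
      have hL := hzero' (X 2 + 6 * X 0 - 7 * X 1)
      have hf := hzero (X 2 + 6 * X 0 - 7 * X 1)
      have hx := hf _ hx
      have hy := hf _ hy
      have hz := hf _ hz
      have hxy := hf _ hxy
      have hyz := hf _ hyz
      simp only [map_sub, map_add, map_mul, map_pow, map_ofNat, sub_eq_zero] at hL hx hy hz hxy hyz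
      obtain ⟨N, hN, h⟩ := exists_monomials_eq_zero_of_alpha_eq_two
        (quotient_intCast_mul_eq_zero _) hc hac hβ hL.symm (by rw [hy]; ring) hx hz hxy hyz
      refine ⟨N, hN, fun i j k hijk => ?_⟩
      rw [← Ideal.Quotient.eq_zero_iff_mem]
      simp only [map_mul, map_pow]
      linear_combination h k j i (by omega)
  obtain ⟨L, hL, N, hN, hmem⟩ := hsurj
  refine hasWLP_of_duality rfl hhom hL hN _ hvanish (fun i _ u hu h => ?_) (mem_of_monomials_mem hmem)
  refine mem_of_bidegreeFunctional_mul_eq_zero (by omega) ?_ hcongr hcompl hu h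
  rcases hα with rfl | rfl <;> omega
end

section
/- Let K be a field of characteristic zero, R = K[x,y,z], and let a, b, α, β be integers with 1 ≤ α ≤ a−1, 1 ≤ β ≤ b−1, α + 2 = b (so γ = 2). Let I_β = (x^a, y^b − x^α z^2, z^3, x^{a−α} y^{b−β}, y^{b−β} z) and set k = ⌊(a+b−β)/2⌋. Then h_{R/I_β}(k) = 3b−4 if a = b−1 and β = 1; h_{R/I_β}(k) = 3b−3 if a = b and β = 1; h_{R/I_β}(k) = 3b−2β if β ≤ a−b+1 and a ≠ b; and h_{R/I_β}(k) = a+2b−3β+2 if β ≥ a−b+2 ≥ 2. -/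
open MvPolynomial

/-- The monomial `x ^ i * y ^ j * z ^ l`. -/
noncomputable def xyzMonomial (K : Type*) [Field K] (i j l : ℕ) : MvPolynomial (Fin 3) K :=
  X 0 ^ i * X 1 ^ j * X 2 ^ l

/-- The ideal `I_β` in the case `γ = 2`. -/
noncomputable def idealBeta (K : Type*) [Field K] (a b α β : ℕ) :
    Ideal (MvPolynomial (Fin 3) K) :=
  Ideal.span
    {(X 0 : MvPolynomial (Fin 3) K) ^ a, X 1 ^ b - X 0 ^ α * X 2 ^ 2, X 2 ^ 3,
      X 0 ^ (a - α) * X 1 ^ (b - β), X 1 ^ (b - β) * X 2}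

/-- Exponents of the monomials outside the initial ideal of `idealBeta`, for an order in which
`y ^ b` is the leading term of `y ^ b - x ^ α * z ^ 2`. -/
def IsStandard (a b α β i j l : ℕ) : Prop :=
  i < a ∧ j < b ∧ l < 3 ∧ ¬ (a - α ≤ i ∧ b - β ≤ j) ∧ ¬ (b - β ≤ j ∧ 1 ≤ l)

instance (a b α β i j l : ℕ) : Decidable (IsStandard a b α β i j l) := by
  unfold IsStandard; infer_instance

/-- The normal form modulo `idealBeta` of a monomial. -/
noncomputable def monomialNormalForm (K : Type*) [Field K] (a b α β i j l : ℕ) :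
    MvPolynomial (Fin 3) K :=
  if IsStandard a b α β i j l then xyzMonomial K i j l
  else if b ≤ j ∧ IsStandard a b α β (i + α) (j - b) (l + 2) then
    xyzMonomial K (i + α) (j - b) (l + 2)
  else 0

/-- The normal form modulo `idealBeta`, as a linear map. -/
noncomputable def normalForm (K : Type*) [Field K] (a b α β : ℕ) :
    MvPolynomial (Fin 3) K →ₗ[K] MvPolynomial (Fin 3) K :=
  (basisMonomials (Fin 3) K).constr K
    fun s => monomialNormalForm K a b α β (s 0) (s 1) (s 2)

section

variable {K : Type*} [Field K] {a b α β : ℕ}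

theorem monomial_eq_xyzMonomial (s : Fin 3 →₀ ℕ) :
    monomial s (1 : K) = xyzMonomial K (s 0) (s 1) (s 2) := by
  rw [monomial_eq, xyzMonomial, Finsupp.prod_fintype _ _ (by simp)]
  simp [Fin.prod_univ_three]

theorem exists_xyzMonomial_eq_monomial (i j l : ℕ) :
    ∃ s : Fin 3 →₀ ℕ, s 0 = i ∧ s 1 = j ∧ s 2 = l ∧
      xyzMonomial K i j l = monomial s (1 : K) :=
  ⟨Finsupp.equivFunOnFinite.symm ![i, j, l], by simp, by simp, by simp, by
    simp [monomial_eq_xyzMonomial]⟩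

theorem xyzMonomial_mul (i j l i' j' l' : ℕ) :
    xyzMonomial K i j l * xyzMonomial K i' j' l' = xyzMonomial K (i + i') (j + j') (l + l') := by
  simp only [xyzMonomial]; ring

theorem xyzMonomial_isHomogeneous (i j l : ℕ) :
    (xyzMonomial K i j l).IsHomogeneous (i + j + l) :=
  ((isHomogeneous_X_pow _ _).mul (isHomogeneous_X_pow _ _)).mul (isHomogeneous_X_pow _ _)

theorem idealBeta_eq : idealBeta K a b α β = Ideal.span
    {xyzMonomial K a 0 0, xyzMonomial K 0 b 0 - xyzMonomial K α 0 2, xyzMonomial K 0 0 3,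
      xyzMonomial K (a - α) (b - β) 0, xyzMonomial K 0 (b - β) 1} := by
  simp [idealBeta, xyzMonomial]

theorem normalForm_xyzMonomial (i j l : ℕ) :
    normalForm K a b α β (xyzMonomial K i j l) = monomialNormalForm K a b α β i j l := by
  obtain ⟨s, rfl, rfl, rfl, h⟩ := exists_xyzMonomial_eq_monomial (K := K) i j l
  rw [h, normalForm]
  exact (basisMonomials (Fin 3) K).constr_basis K _ s

theorem normalForm_mul_eq_zero {g : MvPolynomial (Fin 3) K}
    (hg : ∀ i j l, normalForm K a b α β (xyzMonomial K i j l * g) = 0)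
    (f : MvPolynomial (Fin 3) K) : normalForm K a b α β (f * g) = 0 := by
  induction f using MvPolynomial.induction_on' with
  | monomial s c =>
    rw [show monomial s c = c • monomial s (1 : K) by simp [smul_monomial], smul_mul_assoc,
      map_smul, monomial_eq_xyzMonomial, hg, smul_zero]
  | add p q hp hq => rw [add_mul, map_add, hp, hq, add_zero]

theorem normalForm_eq_zero_of_mem (hα : α ≤ a) (hβb : β < b)
    {f : MvPolynomial (Fin 3) K} (hf : f ∈ idealBeta K a b α β) :
    normalForm K a b α β f = 0 := by
  rw [idealBeta_eq] at hf
  suffices h : ∀ p, normalForm K a b α β (p * f) = 0 by simpa using h 1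
  induction hf using Submodule.span_induction with
  | zero => simp
  | add p q _ _ hp hq => intro r; rw [mul_add, map_add, hp, hq, add_zero]
  | smul c p _ hp => intro r; rw [smul_eq_mul, ← mul_assoc, hp]
  | mem g hg =>
    refine normalForm_mul_eq_zero fun i j l => ?_
    simp only [Set.mem_insert_iff, Set.mem_singleton_iff] at hg
    rcases hg with rfl | rfl | rfl | rfl | rfl
    · rw [xyzMonomial_mul, normalForm_xyzMonomial, monomialNormalForm, if_neg, if_neg] <;>
        unfold IsStandard <;> omega
    · rw [mul_sub, xyzMonomial_mul, xyzMonomial_mul, map_sub, normalForm_xyzMonomial,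
        normalForm_xyzMonomial, sub_eq_zero, monomialNormalForm, monomialNormalForm]
      simp only [add_zero, Nat.add_sub_cancel]
      rw [if_neg (by unfold IsStandard; omega)]
      by_cases h : IsStandard a b α β (i + α) j (l + 2)
      · rw [if_pos ⟨by omega, h⟩, if_pos h]
      · rw [if_neg fun h' => h h'.2, if_neg h, if_neg]
        unfold IsStandard; omega
    all_goals
      rw [xyzMonomial_mul, normalForm_xyzMonomial, monomialNormalForm, if_neg, if_neg] <;>
        unfold IsStandard <;> omega

theorem xyzMonomial_mem_of_le {J : Ideal (MvPolynomial (Fin 3) K)} {i j l i' j' l' : ℕ}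
    (h : xyzMonomial K i j l ∈ J) (hi : i ≤ i') (hj : j ≤ j') (hl : l ≤ l') :
    xyzMonomial K i' j' l' ∈ J := by
  have := J.mul_mem_left (xyzMonomial K (i' - i) (j' - j) (l' - l)) h
  rwa [xyzMonomial_mul, Nat.sub_add_cancel hi, Nat.sub_add_cancel hj, Nat.sub_add_cancel hl]
    at this

theorem xyzMonomial_mem_idealBeta {i j l : ℕ} (h : ¬ IsStandard a b α β i j l)
    (hjl : j < b ∨ 1 ≤ l) : xyzMonomial K i j l ∈ idealBeta K a b α β := by
  have hcases : a ≤ i ∨ 3 ≤ l ∨ (a - α ≤ i ∧ b - β ≤ j) ∨ (b - β ≤ j ∧ 1 ≤ l) := by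
    unfold IsStandard at h; omega
  rw [idealBeta_eq]
  rcases hcases with h | h | h | h
  · exact xyzMonomial_mem_of_le (i := a) (j := 0) (l := 0)
      (Ideal.subset_span (by simp)) h (by omega) (by omega)
  · exact xyzMonomial_mem_of_le (i := 0) (j := 0) (l := 3)
      (Ideal.subset_span (by simp)) (by omega) (by omega) h
  · exact xyzMonomial_mem_of_le (i := a - α) (j := b - β) (l := 0)
      (Ideal.subset_span (by simp)) h.1 h.2 (by omega)
  · exact xyzMonomial_mem_of_le (i := 0) (j := b - β) (l := 1)
      (Ideal.subset_span (by simp)) (by omega) h.1 h.2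

theorem mk_xyzMonomial_of_le {i j l : ℕ} (h : b ≤ j) :
    Ideal.Quotient.mk (idealBeta K a b α β) (xyzMonomial K i j l) =
      Ideal.Quotient.mk (idealBeta K a b α β) (xyzMonomial K (i + α) (j - b) (l + 2)) := by
  rw [Ideal.Quotient.eq]
  have hg : xyzMonomial K 0 b 0 - xyzMonomial K α 0 2 ∈ idealBeta K a b α β := by
    rw [idealBeta_eq]; exact Ideal.subset_span (by simp)
  have := Ideal.mul_mem_left _ (xyzMonomial K i (j - b) l) hg
  rwa [mul_sub, xyzMonomial_mul, xyzMonomial_mul, Nat.sub_add_cancel h] at this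

/-- The exponents `(j, l)` of `y` and `z` in the standard monomials of degree `k`. -/
def standardExponents (a b α β k : ℕ) : Finset (ℕ × ℕ) :=
  (Finset.range b ×ˢ Finset.range 3).filter fun p =>
    p.1 + p.2 ≤ k ∧ IsStandard a b α β (k - p.1 - p.2) p.1 p.2

/-- The class of the monomial of degree `k` with given exponents of `y` and `z`. -/
noncomputable def standardClass (K : Type*) [Field K] (a b α β k : ℕ)
    (p : standardExponents a b α β k) : MvPolynomial (Fin 3) K ⧸ idealBeta K a b α β :=
  Ideal.Quotient.mk _ (xyzMonomial K (k - p.1.1 - p.1.2) p.1.1 p.1.2)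

theorem linearIndependent_xyzMonomial :
    LinearIndependent K fun p : ℕ × ℕ × ℕ => xyzMonomial K p.1 p.2.1 p.2.2 := by
  choose s h0 h1 h2 hs using fun p : ℕ × ℕ × ℕ =>
    exists_xyzMonomial_eq_monomial (K := K) p.1 p.2.1 p.2.2
  have hinj : Function.Injective s := fun p q h => by
    ext
    · rw [← h0 p, ← h0 q, h]
    · rw [← h1 p, ← h1 q, h]
    · rw [← h2 p, ← h2 q, h]
  have := (basisMonomials (Fin 3) K).linearIndependent.comp s hinj
  simpa only [hs, coe_basisMonomials, Function.comp_def] using this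

theorem linearIndependent_standardClass (hα : α ≤ a) (hβb : β < b) (k : ℕ) :
    LinearIndependent K (standardClass K a b α β k) := by
  have hker : (idealBeta K a b α β).restrictScalars K ≤ LinearMap.ker (normalForm K a b α β) :=
    fun f hf => normalForm_eq_zero_of_mem hα hβb hf
  let N : (MvPolynomial (Fin 3) K ⧸ idealBeta K a b α β) →ₗ[K] MvPolynomial (Fin 3) K :=
    Submodule.liftQ ((idealBeta K a b α β).restrictScalars K) (normalForm K a b α β) hker
  refine LinearIndependent.of_comp N ?_
  have hcomp : N ∘ standardClass K a b α β k = (fun p : ℕ × ℕ × ℕ => xyzMonomial K p.1 p.2.1 p.2.2) ∘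
      fun p : standardExponents a b α β k => (k - p.1.1 - p.1.2, p.1.1, p.1.2) := by
    funext p
    change normalForm K a b α β _ = xyzMonomial K _ _ _
    rw [normalForm_xyzMonomial, monomialNormalForm, if_pos (Finset.mem_filter.1 p.2).2.2]
  rw [hcomp]
  refine linearIndependent_xyzMonomial.comp _ fun p q h => ?_
  simp only [Prod.mk.injEq] at h
  exact Subtype.ext (Prod.ext h.2.1 h.2.2)

theorem span_standardClass (hαb : α + 2 = b) (k : ℕ) :
    Submodule.span K (Set.range (standardClass K a b α β k)) =
      grComponent K (idealBeta K a b α β) k := by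
  have hstd : ∀ {i j l : ℕ}, i + j + l = k → IsStandard a b α β i j l →
      Ideal.Quotient.mk (idealBeta K a b α β) (xyzMonomial K i j l) ∈
        Submodule.span K (Set.range (standardClass K a b α β k)) := by
    intro i j l hk h
    have hi : k - j - l = i := by omega
    refine Submodule.subset_span ⟨⟨(j, l), ?_⟩, by rw [standardClass]; simp only [hi]⟩
    simp only [standardExponents, Finset.mem_filter, Finset.mem_product, Finset.mem_range, hi]
    exact ⟨⟨h.2.1, h.2.2.1⟩, by omega, h⟩
  apply le_antisymm
  · rw [Submodule.span_le]
    rintro _ ⟨p, rfl⟩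
    refine ⟨xyzMonomial K (k - p.1.1 - p.1.2) p.1.1 p.1.2, ?_, rfl⟩
    have hp := (Finset.mem_filter.1 p.2).2.1
    have := xyzMonomial_isHomogeneous (K := K) (k - p.1.1 - p.1.2) p.1.1 p.1.2
    rwa [show k - p.1.1 - p.1.2 + p.1.1 + p.1.2 = k by omega] at this
  · rintro _ ⟨f, hf, rfl⟩
    rw [f.as_sum, map_sum]
    refine Submodule.sum_mem _ fun s hs => ?_
    have hdeg : s 0 + s 1 + s 2 = k := by
      rw [← (hf : f.IsHomogeneous k) (mem_support_iff.1 hs), Finsupp.weight_apply,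
        Finsupp.sum_fintype _ _ (by simp)]
      simp [Fin.sum_univ_three]
    rw [show monomial s (coeff s f) = coeff s f • monomial s (1 : K) by simp [smul_monomial],
      map_smul, monomial_eq_xyzMonomial]
    refine Submodule.smul_mem _ _ ?_
    change Ideal.Quotient.mk _ _ ∈ _
    by_cases h : IsStandard a b α β (s 0) (s 1) (s 2)
    · exact hstd hdeg h
    by_cases hj : b ≤ s 1
    · rw [mk_xyzMonomial_of_le hj]
      by_cases h' : IsStandard a b α β (s 0 + α) (s 1 - b) (s 2 + 2)
      · exact hstd (by omega) h'
      · rw [Ideal.Quotient.eq_zero_iff_mem.2 (xyzMonomial_mem_idealBeta h' (by omega))]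
        exact zero_mem _
    · rw [Ideal.Quotient.eq_zero_iff_mem.2 (xyzMonomial_mem_idealBeta h (by omega))]
      exact zero_mem _

theorem hilb_idealBeta (hα : α ≤ a) (hβb : β < b) (hαb : α + 2 = b) (k : ℕ) :
    hilb K (idealBeta K a b α β) k = (standardExponents a b α β k).card := by
  rw [hilb, ← span_standardClass hαb,
    finrank_span_eq_card (linearIndependent_standardClass hα hβb k), Fintype.card_coe]

theorem card_standardExponents {k n₁ n₂ : ℕ} (s : Finset ℕ)
    (h₀ : ∀ j, j < b ∧ j ≤ k ∧ IsStandard a b α β (k - j) j 0 ↔ j ∈ s)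
    (h₁ : ∀ j, j < b ∧ j + 1 ≤ k ∧ IsStandard a b α β (k - j - 1) j 1 ↔ j < n₁)
    (h₂ : ∀ j, j < b ∧ j + 2 ≤ k ∧ IsStandard a b α β (k - j - 2) j 2 ↔ j < n₂) :
    (standardExponents a b α β k).card = s.card + n₁ + n₂ := by
  have e : standardExponents a b α β k =
      s ×ˢ {0} ∪ (Finset.range n₁ ×ˢ {1} ∪ Finset.range n₂ ×ˢ {2}) := by
    ext ⟨j, l⟩
    simp only [standardExponents, Finset.mem_filter, Finset.mem_product, Finset.mem_range,
      Finset.mem_union, Finset.mem_singleton, ← h₀, ← h₁, ← h₂]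
    constructor
    · rintro ⟨⟨hj, hl⟩, h⟩
      interval_cases l <;> simp_all
    · rintro (⟨h, rfl⟩ | ⟨h, rfl⟩ | ⟨h, rfl⟩) <;> simp_all
  rw [e, Finset.card_union_of_disjoint, Finset.card_union_of_disjoint]
  · simp [add_assoc]
  · rw [Finset.disjoint_left]; rintro ⟨j, l⟩; simp; omega
  · rw [Finset.disjoint_left]; rintro ⟨j, l⟩; simp; omega

end

theorem stmt_14 (K : Type*) [Field K] [CharZero K] (a b α β : ℕ)
    (hα1 : 1 ≤ α) (hα2 : α ≤ a - 1)
    (hβ1 : 1 ≤ β) (hβ2 : β ≤ b - 1)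
    (hαb : α + 2 = b) :
    let I : Ideal (MvPolynomial (Fin 3) K) := Ideal.span
      {(X 0 : MvPolynomial (Fin 3) K) ^ a, X 1 ^ b - X 0 ^ α * X 2 ^ 2, X 2 ^ 3,
        X 0 ^ (a - α) * X 1 ^ (b - β), X 1 ^ (b - β) * X 2}
    let k : ℕ := (a + b - β) / 2
    ((a + 1 = b ∧ β = 1 → (hilb K I k : ℤ) = 3 * b - 4) ∧
     (a = b ∧ β = 1 → (hilb K I k : ℤ) = 3 * b - 3) ∧
     ((β : ℤ) ≤ (a : ℤ) - b + 1 ∧ a ≠ b → (hilb K I k : ℤ) = 3 * b - 2 * β) ∧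
     ((a : ℤ) - b + 2 ≤ (β : ℤ) ∧ (2 : ℤ) ≤ (a : ℤ) - b + 2 →
        (hilb K I k : ℤ) = a + 2 * b - 3 * β + 2)) := by
  intro I k
  have hI : hilb K I k = (standardExponents a b α β k).card :=
    hilb_idealBeta (by omega) (by omega) hαb k
  have hk : k = (a + b - β) / 2 := rfl
  clear_value k
  rw [hI]
  refine ⟨fun h => ?_, fun h => ?_, fun h => ?_, fun h => ?_⟩
  · rw [card_standardExponents (n₁ := a) (n₂ := a - 1) (Finset.Ico 1 (a + 1)), Nat.card_Ico] <;>
      (try simp only [IsStandard, Finset.mem_Ico]) <;> omega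
  · rw [card_standardExponents (n₁ := a - 1) (n₂ := a - 2) (Finset.range a),
      Finset.card_range] <;> (try simp only [IsStandard, Finset.mem_range]) <;> omega
  · rw [card_standardExponents (n₁ := b - β) (n₂ := b - β) (Finset.range b),
      Finset.card_range] <;> (try simp only [IsStandard, Finset.mem_range]) <;> omega
  · have hsub : Finset.Ico (b - β) (k + b - a - 1) ⊆ Finset.range (k + 1) := by
      intro j; simp only [Finset.mem_Ico, Finset.mem_range]; omega
    rw [card_standardExponents (n₁ := b - β) (n₂ := b - β)
      (Finset.range (k + 1) \ Finset.Ico (b - β) (k + b - a - 1)),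
      Finset.card_sdiff_of_subset hsub, Finset.card_range, Nat.card_Ico] <;>
      (try simp only [IsStandard, Finset.mem_sdiff, Finset.mem_Ico, Finset.mem_range]) <;> omega
end
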